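/- arXiv:1005.5266 — 3 statements merged into one kernel-verified Lean document; each statement's English description precedes it below -/
import Mathlib

section
/- Let 𝔤 be a finite-dimensional semisimple Lie algebra over an algebraically closed field K of characteristic 0 and let V be a faithful irreducible 𝔤-module of dimension r ≥ 2 such that (V^{⊗n})^𝔤 = 0 for all integers n with 1 ≤ n < r. If moreover dim_K (V^{⊗r})^𝔤 ≤ 3, or if r is a prime power, then 𝔤 is a simple Lie algebra. -/
open scoped TensorProduct

/-- The action of an element `x` of a Lie algebra `𝔤` on the `n`-fold tensor power `V^{⊗n}`
of a `𝔤`-module `V`, acting as a derivation (i.e. by the Leibniz rule, applying `x` to one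
tensor factor at a time and summing). -/
noncomputable def tensorPowerLieAction (K : Type*) [CommRing K]
    (𝔤 : Type*) [LieRing 𝔤] [LieAlgebra K 𝔤]
    (V : Type*) [AddCommGroup V] [Module K V] [LieRingModule 𝔤 V] [LieModule K 𝔤 V]
    (n : ℕ) (x : 𝔤) : Module.End K (⨂[K]^n V) :=
  ∑ i : Fin n, PiTensorProduct.map
    (Function.update (fun _ : Fin n => (LinearMap.id : V →ₗ[K] V)) i (LieModule.toEnd K 𝔤 V x))

/-- The subspace `(V^{⊗n})^𝔤` of `𝔤`-invariants of the `n`-fold tensor power of `V`. -/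
noncomputable def tensorPowerInvariants (K : Type*) [CommRing K]
    (𝔤 : Type*) [LieRing 𝔤] [LieAlgebra K 𝔤]
    (V : Type*) [AddCommGroup V] [Module K V] [LieRingModule 𝔤 V] [LieModule K 𝔤 V]
    (n : ℕ) : Submodule K (⨂[K]^n V) :=
  ⨅ x : 𝔤, LinearMap.ker (tensorPowerLieAction K 𝔤 V n x)

open scoped Kronecker

section Coordinates

variable {K : Type*} [CommRing K]

/-- The derivation action of a matrix `X` on functions of `σ`-tuples of indices, i.e. on
coordinates of tensors. -/
def coordAction {σ ι : Type*} [Fintype σ] [DecidableEq σ] [Fintype ι]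
    (X : Matrix ι ι K) (F : (σ → ι) → K) (p : σ → ι) : K :=
  ∑ i, ∑ a, X (p i) a * F (Function.update p i a)

/-- The matrix whose `i`-th row is the standard basis vector with index `q i`. -/
def rowMatrix (K : Type*) [CommRing K] {ι : Type*} [DecidableEq ι] (q : ι → ι) : Matrix ι ι K :=
  Matrix.of fun i => Pi.single (q i) 1

lemma rowMatrix_apply {ι : Type*} [DecidableEq ι] (q : ι → ι) (i j : ι) :
    rowMatrix K q i j = Pi.single (M := fun _ => K) (q i) 1 j := rfl

lemma rowMatrix_update {ι : Type*} [DecidableEq ι] (q : ι → ι) (i a : ι) :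
    rowMatrix K (Function.update q i a) = (rowMatrix K q).updateRow i (Pi.single a 1) := by
  ext j b
  by_cases h : j = i
  · subst h; simp [rowMatrix]
  · simp [rowMatrix, h, Matrix.updateRow_ne]

lemma coordAction_det {ι : Type*} [Fintype ι] [DecidableEq ι] (X : Matrix ι ι K)
    (hX : X.trace = 0) (q : ι → ι) :
    coordAction X (fun q => (rowMatrix K q).det) q = 0 := by
  have h : coordAction X (fun q => (rowMatrix K q).det) q
      = (rowMatrix K q * (X * (rowMatrix K q).adjugate)).trace := by
    simp only [coordAction, rowMatrix_update, ← Matrix.adjugate_apply, Matrix.trace,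
      Matrix.diag_apply]
    refine Finset.sum_congr rfl fun i _ => ?_
    symm
    rw [Matrix.mul_apply (M := rowMatrix K q), Finset.sum_eq_single (q i)]
    · rw [rowMatrix_apply, Pi.single_eq_same, one_mul, Matrix.mul_apply]
    · intro b _ hb
      rw [rowMatrix_apply, Pi.single_eq_of_ne hb, zero_mul]
    · simp
  rw [h, Matrix.trace_mul_comm, Matrix.mul_assoc, Matrix.adjugate_mul]
  simp [hX]

/-- The product over `l : μ` of the determinants of the blocks `q (e (l, ·))`. -/
def blockDet (K : Type*) [CommRing K] {σ μ ι : Type*} [Fintype μ] [Fintype ι] [DecidableEq ι]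
    (e : μ × ι ≃ σ) (q : σ → ι) : K :=
  ∏ l, (rowMatrix K fun j => q (e (l, j))).det

lemma coordAction_blockDet {σ μ ι : Type*} [Fintype σ] [DecidableEq σ] [Fintype μ]
    [Fintype ι] [DecidableEq ι] (e : μ × ι ≃ σ) (X : Matrix ι ι K)
    (hX : X.trace = 0) (q : σ → ι) : coordAction X (blockDet K e) q = 0 := by
  classical
  have h (l : μ) (j a : ι) : blockDet K e (Function.update q (e (l, j)) a) =
      (∏ m ∈ Finset.univ.erase l, (rowMatrix K fun j => q (e (m, j))).det) *
        (rowMatrix K (Function.update (fun j => q (e (l, j))) j a)).det := by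
    rw [blockDet, ← Finset.prod_erase_mul _ _ (Finset.mem_univ l)]
    congr 1
    · refine Finset.prod_congr rfl fun m hm => ?_
      congr 2
      ext j'
      rw [Function.update_of_ne]
      simp [(Finset.mem_erase.1 hm).1]
    · congr 2
      ext j'
      simp [Function.update_apply]
  rw [coordAction, ← e.sum_comp, Fintype.sum_prod_type]
  refine Finset.sum_eq_zero fun l _ => ?_
  have h0 := coordAction_det X hX (fun j => q (e (l, j)))
  rw [coordAction] at h0
  refine Eq.trans ?_ (congrArg
    ((∏ m ∈ Finset.univ.erase l, (rowMatrix K fun j => q (e (m, j))).det) * ·) h0 |>.trans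
    (mul_zero _))
  simp only [h, Finset.mul_sum]
  exact Finset.sum_congr rfl fun j _ => Finset.sum_congr rfl fun a _ => mul_left_comm _ _ _

lemma coordAction_kronecker {σ ι κ : Type*} [Fintype σ] [DecidableEq σ] [Fintype ι]
    [Fintype κ] [DecidableEq ι] [DecidableEq κ] (X : Matrix ι ι K) (Y : Matrix κ κ K)
    (G : (σ → ι) → K) (H : (σ → κ) → K) (p : σ → ι × κ) :
    coordAction (X ⊗ₖ (1 : Matrix κ κ K) + (1 : Matrix ι ι K) ⊗ₖ Y)
      (fun p => G (Prod.fst ∘ p) * H (Prod.snd ∘ p)) p =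
    coordAction X G (Prod.fst ∘ p) * H (Prod.snd ∘ p) +
      G (Prod.fst ∘ p) * coordAction Y H (Prod.snd ∘ p) := by
  have h1 (i : σ) (a : ι × κ) : Prod.fst ∘ Function.update p i a =
      Function.update (Prod.fst ∘ p) i a.1 := Function.comp_update ..
  have h2 (i : σ) (a : ι × κ) : Prod.snd ∘ Function.update p i a =
      Function.update (Prod.snd ∘ p) i a.2 := Function.comp_update ..
  have h3 (i : σ) : Function.update (Prod.fst ∘ p) i (p i).1 = Prod.fst ∘ p :=
    Function.update_eq_self i _
  have h4 (i : σ) : Function.update (Prod.snd ∘ p) i (p i).2 = Prod.snd ∘ p :=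
    Function.update_eq_self i _
  simp only [coordAction, Finset.sum_mul, Finset.mul_sum, ← Finset.sum_add_distrib]
  refine Finset.sum_congr rfl fun i _ => ?_
  simp only [Fintype.sum_prod_type, h1, h2, Matrix.add_apply, Matrix.kroneckerMap_apply, add_mul,
    Finset.sum_add_distrib, Matrix.one_apply, mul_ite, ite_mul, mul_one, one_mul, mul_zero,
    zero_mul, Finset.sum_ite_eq, Finset.mem_univ, if_true, h4]
  congr 1
  · simp [mul_assoc]
  · rw [Finset.sum_comm]
    simp [h3, mul_left_comm]

lemma blockDet_eq_one {σ μ ι : Type*} [Fintype μ] [Fintype ι] [DecidableEq ι] (e : μ × ι ≃ σ) :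
    blockDet K e (fun s => (e.symm s).2) = 1 := by
  refine Finset.prod_eq_one fun l _ => ?_
  rw [show (rowMatrix K fun j => (e.symm (e (l, j))).2) = 1 by
    ext i j; simp [rowMatrix, Matrix.one_apply, Pi.single_apply, eq_comm]]
  simp

lemma blockDet_eq_zero {σ μ ι : Type*} [Fintype μ] [Fintype ι] [DecidableEq ι] (e : μ × ι ≃ σ)
    (q : σ → ι) (l : μ) (i j : ι) (hij : i ≠ j) (h : q (e (l, i)) = q (e (l, j))) :
    blockDet K e q = 0 := by
  refine Finset.prod_eq_zero (Finset.mem_univ l) (Matrix.det_zero_of_row_eq hij ?_)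
  ext
  simp [rowMatrix, h]

/-- There are two block determinants, and two tuples on which they form the identity matrix. -/
lemma exists_blockDet_pair (K : Type*) [CommRing K] {σ : Type*} {m d : ℕ} (hm : 2 ≤ m)
    (hd : 2 ≤ d) (e : Fin m × Fin d ≃ σ) :
    ∃ (f : Fin 2 → (Fin m × Fin d ≃ σ)) (q : Fin 2 → (σ → Fin d)),
      ∀ a b, blockDet K (f a) (q b) = if a = b then 1 else 0 := by
  classical
  let m0 : Fin m := ⟨0, by omega⟩
  let m1 : Fin m := ⟨1, by omega⟩
  let d0 : Fin d := ⟨0, by omega⟩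
  let d1 : Fin d := ⟨1, by omega⟩
  have hd01 : d0 ≠ d1 := by simp [d0, d1]
  have hm01 : m0 ≠ m1 := by simp [m0, m1]
  let s := Equiv.swap (m0, d0) (m1, d1)
  let f : Fin 2 → (Fin m × Fin d ≃ σ) := ![e, s.trans e]
  have hs0 : s (m0, d0) = (m1, d1) := Equiv.swap_apply_left _ _
  have hs1 : s (m0, d1) = (m0, d1) :=
    Equiv.swap_apply_of_ne_of_ne (by simp [hd01.symm]) (by simp [hm01])
  have hs : s.symm = s := Equiv.symm_swap _ _
  refine ⟨f, fun b s => ((f b).symm s).2, fun a b => ?_⟩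
  split_ifs with hab
  · rw [hab, blockDet_eq_one]
  · have hz : ∀ a b, a ≠ b → blockDet K (f a) (fun s => ((f b).symm s).2) = 0 := by
      intro a b hab
      refine blockDet_eq_zero _ _ m0 d0 d1 hd01 ?_
      fin_cases a <;> fin_cases b <;> simp [f, hs, hs0, hs1] at hab ⊢
    exact hz a b hab

end Coordinates

lemma exists_basis_kronecker_of_linearEquiv {K A V U : Type*} [Field K] [IsAlgClosed K]
    [Ring A] [Algebra K A]
    [AddCommGroup V] [Module K V] [Module A V] [IsScalarTower K A V]
    [AddCommGroup U] [Module K U] [Module A U] [IsScalarTower K A U]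
    [FiniteDimensional K U] [IsSimpleModule A U] {k : ℕ} (φ : V ≃ₗ[A] (Fin k → U)) :
    ∃ (d : ℕ) (b : Module.Basis (Fin d × Fin k) K V),
      (∀ a : A, ∃ X, LinearMap.toMatrix b b (Module.toModuleEnd K V a) =
        X ⊗ₖ (1 : Matrix (Fin k) (Fin k) K)) ∧
      (∀ t : Module.End A V, ∃ Y, LinearMap.toMatrix b b (t.restrictScalars K) =
        (1 : Matrix (Fin d) (Fin d) K) ⊗ₖ Y) := by
  classical
  let e := Module.finBasis K U
  let b := ((Pi.basis fun _ : Fin k => e).map (φ.restrictScalars K).symm).reindex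
    ((Equiv.sigmaEquivProd _ _).trans (Equiv.prodComm _ _))
  have hb : ∀ i j, b (i, j) = φ.symm (Pi.single j (e i)) := fun i j => by
    simp [b, Pi.basis_apply]
  have hr : ∀ v i j, b.repr v (i, j) = e.repr (φ v j) i := fun v i j => by
    rw [Module.Basis.repr_reindex_apply]
    exact Pi.basis_repr ..
  refine ⟨_, b, fun a => ⟨LinearMap.toMatrix e e (Module.toModuleEnd K U a), ?_⟩, fun t => ?_⟩
  · ext ⟨i, j⟩ ⟨i', j'⟩
    simp only [LinearMap.toMatrix_apply, hr, hb, Module.toModuleEnd_apply,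
      DistribSMul.toLinearMap_apply, Matrix.kroneckerMap_apply, map_smul,
      LinearEquiv.apply_symm_apply, Pi.smul_apply]
    rcases eq_or_ne j j' with rfl | h
    · simp
    · simp [h]
  · let c (j j' : Fin k) : Module.End A U :=
      LinearMap.proj j ∘ₗ φ.toLinearMap ∘ₗ t ∘ₗ φ.symm.toLinearMap ∘ₗ
        LinearMap.single A (fun _ => U) j'
    choose y hy using fun j j' =>
      (IsSimpleModule.algebraMap_end_bijective_of_isAlgClosed (A := A) (V := U) K).2 (c j j')
    refine ⟨Matrix.of y, ?_⟩
    ext ⟨i, j⟩ ⟨i', j'⟩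
    have h := LinearMap.congr_fun (hy j j') (e i')
    simp only [LinearMap.toMatrix_apply, hr, hb, Matrix.kroneckerMap_apply]
    trans e.repr (c j j' (e i')) i
    · rfl
    · rw [← h]
      simp [Matrix.one_apply, Finsupp.single_apply, eq_comm, mul_comm]

lemma exists_linearEquiv_fun_of_isotypicComponent_eq_top {R M : Type*} [Ring R] [AddCommGroup M]
    [Module R M] [Module.Finite R M] {U : Submodule R M} [IsSimpleModule R U]
    (h : isotypicComponent R M U = ⊤) : ∃ k : ℕ, Nonempty (M ≃ₗ[R] (Fin k → U)) := by
  have : IsSemisimpleModule R (⊤ : Submodule R M) := h ▸ inferInstance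
  have : IsSemisimpleModule R M := .congr Submodule.topEquiv.symm
  exact (IsIsotypicOfType.of_isotypicComponent_eq_top h).linearEquiv_fun

lemma exists_basis_kronecker {K V : Type*} [Field K] [IsAlgClosed K] [AddCommGroup V] [Module K V]
    [FiniteDimensional K V] [Nontrivial V] (S T : Set (Module.End K V))
    (hST : ∀ s ∈ S, ∀ t ∈ T, Commute s t)
    (hirr : ∀ W : Submodule K V, (∀ s ∈ S, W ≤ W.comap s) → (∀ t ∈ T, W ≤ W.comap t) →
      W = ⊥ ∨ W = ⊤) :
    ∃ (d k : ℕ) (b : Module.Basis (Fin d × Fin k) K V),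
      (∀ s ∈ S, ∃ X, LinearMap.toMatrix b b s = X ⊗ₖ (1 : Matrix (Fin k) (Fin k) K)) ∧
      (∀ t ∈ T, ∃ Y, LinearMap.toMatrix b b t = (1 : Matrix (Fin d) (Fin d) K) ⊗ₖ Y) := by
  classical
  let A := Algebra.adjoin K S
  have hcomm : ∀ t ∈ T, ∀ a ∈ A, Commute a t := fun t ht a ha => by
    have hle : A ≤ Subalgebra.centralizer K {t} := Algebra.adjoin_le fun s hs =>
      (Subalgebra.mem_centralizer_iff K).2 fun _ h => h ▸ (hST s hs t ht).symm.eq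
    exact ((Subalgebra.mem_centralizer_iff K).1 (hle ha) t rfl).symm
  let toA (t : Module.End K V) (ht : t ∈ T) : Module.End A V :=
    { toFun := t
      map_add' := t.map_add
      map_smul' := fun a v => (LinearMap.congr_fun (hcomm t ht a a.2).eq v).symm }
  have : IsArtinian A V := isArtinian_of_tower K inferInstance
  obtain ⟨U, hU⟩ := IsAtomic.exists_atom (Submodule A V)
  rw [← isSimpleModule_iff_isAtom] at hU
  have htop : isotypicComponent A V U = ⊤ := by
    have := hirr ((isotypicComponent A V U).restrictScalars K)
      (fun s hs v hv => (isotypicComponent A V U).smul_mem ⟨s, Algebra.subset_adjoin hs⟩ hv)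
      (fun t ht v hv => Submodule.IsFullyInvariant.isotypicComponent A V U (toA t ht) hv)
    simpa [(bot_lt_isotypicComponent U).ne'] using this
  have : Module.Finite A V := Module.Finite.of_restrictScalars_finite K A V
  obtain ⟨k, ⟨φ⟩⟩ := exists_linearEquiv_fun_of_isotypicComponent_eq_top htop
  have : FiniteDimensional K U :=
    .of_injective (U.subtype.restrictScalars K) U.injective_subtype
  obtain ⟨d, b, h1, h2⟩ :=
    exists_basis_kronecker_of_linearEquiv (K := K) (A := A) (V := V) (U := U) φ
  exact ⟨d, k, b, fun s hs => h1 ⟨s, Algebra.subset_adjoin hs⟩, fun t ht => h2 (toA t ht)⟩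

lemma repr_tensorPowerLieAction {K 𝔤 V ι : Type*} [CommRing K] [LieRing 𝔤] [LieAlgebra K 𝔤]
    [AddCommGroup V] [Module K V] [LieRingModule 𝔤 V] [LieModule K 𝔤 V] [Fintype ι] [DecidableEq ι]
    (b : Module.Basis ι K V) (n : ℕ) (x : 𝔤) (t : ⨂[K]^n V) (q : Fin n → ι) :
    (Basis.piTensorProduct fun _ => b).repr (tensorPowerLieAction K 𝔤 V n x t) q =
      coordAction (LinearMap.toMatrix b b (LieModule.toEnd K 𝔤 V x))
        ((Basis.piTensorProduct fun _ => b).repr t) q := by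
  induction t using PiTensorProduct.induction_on with
  | add s t hs ht =>
    simp only [map_add, Finsupp.add_apply, hs, ht, coordAction, mul_add, Finset.sum_add_distrib]
  | smul_tprod c v =>
    simp only [map_smul, Finsupp.smul_apply, smul_eq_mul, coordAction, mul_left_comm _ c,
      ← Finset.mul_sum]
    congr 1
    simp only [tensorPowerLieAction, LinearMap.sum_apply, PiTensorProduct.map_tprod, map_sum,
      Finsupp.finsetSum_apply, Basis.piTensorProduct_repr_tprod_apply]
    refine Finset.sum_congr rfl fun i _ => ?_
    have hM := congrFun (LinearMap.toMatrix_mulVec_repr b b (LieModule.toEnd K 𝔤 V x) (v i)) (q i)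
    rw [← Finset.mul_prod_erase _ _ (Finset.mem_univ i), Function.update_self, ← hM,
      Matrix.mulVec, dotProduct, Finset.sum_mul]
    refine Finset.sum_congr rfl fun a _ => ?_
    rw [← Finset.mul_prod_erase _ _ (Finset.mem_univ i), Function.update_self, mul_assoc]
    congr 2
    refine Finset.prod_congr rfl fun j hj => ?_
    rw [Function.update_of_ne (Finset.ne_of_mem_erase hj),
      Function.update_of_ne (Finset.ne_of_mem_erase hj)]
    rfl

section Kronecker

variable {K 𝔤 V : Type*} [Field K] [LieRing 𝔤] [LieAlgebra K 𝔤]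
  [AddCommGroup V] [Module K V] [LieRingModule 𝔤 V] [LieModule K 𝔤 V]

/-- The Lie algebra acts in the basis `b` through `𝔰𝔩_d × 𝔰𝔩_k` acting on `K^d ⊗ K^k`. -/
def ActsBySlProd (K 𝔤 : Type*) {V : Type*} [Field K] [LieRing 𝔤] [LieAlgebra K 𝔤]
    [AddCommGroup V] [Module K V] [LieRingModule 𝔤 V] [LieModule K 𝔤 V] {d k : ℕ}
    (b : Module.Basis (Fin d × Fin k) K V) : Prop :=
  ∀ x : 𝔤, ∃ (X : Matrix (Fin d) (Fin d) K) (Y : Matrix (Fin k) (Fin k) K),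
    X.trace = 0 ∧ Y.trace = 0 ∧
      LinearMap.toMatrix b b (LieModule.toEnd K 𝔤 V x) = X ⊗ₖ 1 + 1 ⊗ₖ Y

/-- The tensor with coordinates given by a product of two block determinants. -/
noncomputable def blockTensor {d k m l n : ℕ} (b : Module.Basis (Fin d × Fin k) K V)
    (e : Fin m × Fin d ≃ Fin n) (f : Fin l × Fin k ≃ Fin n) : ⨂[K]^n V :=
  (Basis.piTensorProduct fun _ => b).equivFun.symm
    fun p => blockDet K e (Prod.fst ∘ p) * blockDet K f (Prod.snd ∘ p)

lemma repr_blockTensor {d k m l n : ℕ} (b : Module.Basis (Fin d × Fin k) K V)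
    (e : Fin m × Fin d ≃ Fin n) (f : Fin l × Fin k ≃ Fin n) :
    ⇑((Basis.piTensorProduct fun _ => b).repr (blockTensor b e f)) =
      fun p => blockDet K e (Prod.fst ∘ p) * blockDet K f (Prod.snd ∘ p) :=
  (Basis.piTensorProduct fun _ => b).equivFun.apply_symm_apply _

lemma blockTensor_mem {d k m l n : ℕ} {b : Module.Basis (Fin d × Fin k) K V}
    (hb : ActsBySlProd K 𝔤 b)
    (e : Fin m × Fin d ≃ Fin n) (f : Fin l × Fin k ≃ Fin n) :
    blockTensor b e f ∈ tensorPowerInvariants K 𝔤 V n := by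
  simp only [tensorPowerInvariants, Submodule.mem_iInf, LinearMap.mem_ker]
  intro x
  obtain ⟨X, Y, hX, hY, h⟩ := hb x
  refine (Basis.piTensorProduct fun _ => b).ext_elem fun q => ?_
  rw [repr_tensorPowerLieAction, h, repr_blockTensor, coordAction_kronecker,
    coordAction_blockDet _ _ hX, coordAction_blockDet _ _ hY]
  simp

lemma blockTensor_ne_zero {d k m l n : ℕ} (b : Module.Basis (Fin d × Fin k) K V)
    (e : Fin m × Fin d ≃ Fin n) (f : Fin l × Fin k ≃ Fin n) : blockTensor b e f ≠ 0 := by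
  intro h
  have := congrFun (repr_blockTensor b e f) fun s => ((e.symm s).2, (f.symm s).2)
  simp [h, Function.comp_def, blockDet_eq_one] at this

lemma coprime_of_invariants_eq_bot {d k : ℕ} {b : Module.Basis (Fin d × Fin k) K V}
    (hb : ActsBySlProd K 𝔤 b) (hd : 0 < d) (hk : 0 < k)
    (hinv : ∀ n : ℕ, 1 ≤ n → n < d * k → tensorPowerInvariants K 𝔤 V n = ⊥) : d.Coprime k := by
  by_contra hc
  have hg : 1 < d.gcd k := by
    have := Nat.gcd_pos_of_pos_left k hd
    unfold Nat.Coprime at hc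
    omega
  have hlt : d.lcm k < d * k := by
    have h1 := Nat.gcd_mul_lcm d k
    have h2 := Nat.lcm_pos hd hk
    nlinarith
  obtain ⟨m, hm⟩ := Nat.dvd_lcm_left d k
  obtain ⟨l, hl⟩ := Nat.dvd_lcm_right d k
  let e : Fin m × Fin d ≃ Fin (d.lcm k) := finProdFinEquiv.trans (finCongr (by rw [hm, mul_comm]))
  let f : Fin l × Fin k ≃ Fin (d.lcm k) := finProdFinEquiv.trans (finCongr (by rw [hl, mul_comm]))
  have := blockTensor_mem hb e f
  rw [hinv _ (Nat.lcm_pos hd hk) hlt] at this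
  exact blockTensor_ne_zero b e f this

lemma four_le_finrank_invariants {d k : ℕ} {b : Module.Basis (Fin d × Fin k) K V}
    (hb : ActsBySlProd K 𝔤 b) (hd : 2 ≤ d) (hk : 2 ≤ k) :
    4 ≤ Module.finrank K (tensorPowerInvariants K 𝔤 V (d * k)) := by
  obtain ⟨e, q, heq⟩ := exists_blockDet_pair K hk hd
    (finProdFinEquiv.trans (finCongr (mul_comm k d)))
  obtain ⟨f, p, hfp⟩ := exists_blockDet_pair K hd hk finProdFinEquiv
  let w (a : Fin 2 × Fin 2) : tensorPowerInvariants K 𝔤 V (d * k) :=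
    ⟨blockTensor b (e a.1) (f a.2), blockTensor_mem hb _ _⟩
  have : Module.Finite K (⨂[K]^(d * k) V) :=
    .of_basis (Basis.piTensorProduct fun _ : Fin (d * k) => b)
  have hli : LinearIndependent K w := by
    rw [Fintype.linearIndependent_iff]
    intro g hg a
    have h1 : ∑ c, g c • blockTensor b (e c.1) (f c.2) = 0 := by
      simpa [w] using congrArg Subtype.val hg
    have h2 := congrArg (fun t => (Basis.piTensorProduct fun _ => b).repr t
      fun s => (q a.1 s, p a.2 s)) h1
    simp only [map_sum, map_smul, Finsupp.finsetSum_apply, Finsupp.smul_apply, repr_blockTensor,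
      Function.comp_def, heq, hfp] at h2
    rw [Finset.sum_eq_single a] at h2
    · simpa using h2
    · rintro c - hc
      by_cases h : c.1 = a.1
      · simp [show c.2 ≠ a.2 from fun h' => hc (Prod.ext h h')]
      · simp [h]
    · simp
  simpa using hli.fintype_card_le_finrank

end Kronecker

section LieAlgebra

open LieAlgebra

lemma LieAlgebra.lie_top_top_eq_top (K 𝔤 : Type*) [Field K] [LieRing 𝔤] [LieAlgebra K 𝔤]
    [IsSemisimple K 𝔤] : ⁅(⊤ : LieIdeal K 𝔤), (⊤ : LieIdeal K 𝔤)⁆ = ⊤ := by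
  rw [← compl_eq_bot]
  refine (hasTrivialRadical_iff_no_abelian_ideals K 𝔤).1 inferInstance _ ?_
  rw [LieSubmodule.lie_abelian_iff_lie_self_eq_bot, eq_bot_iff]
  exact (le_inf (LieSubmodule.mono_lie le_top le_top) (LieSubmodule.lie_le_right _ _)).trans
    inf_compl_eq_bot.le

lemma LieAlgebra.IsSemisimple.trace_toEnd_eq_zero {K 𝔤 : Type*} (V : Type*) [Field K] [LieRing 𝔤]
    [LieAlgebra K 𝔤] [IsSemisimple K 𝔤] [AddCommGroup V] [Module K V] [LieRingModule 𝔤 V]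
    [LieModule K 𝔤 V] (x : 𝔤) : LinearMap.trace K V (LieModule.toEnd K 𝔤 V x) = 0 := by
  refine LieModule.trace_toEnd_eq_zero_of_mem_lcs K 𝔤 V le_rfl ?_
  rw [LieModule.lowerCentralSeries_succ, LieModule.lowerCentralSeries_zero, lie_top_top_eq_top]
  trivial

variable {K 𝔤 V : Type*} [Field K] [LieRing 𝔤] [LieAlgebra K 𝔤]
  [AddCommGroup V] [Module K V] [LieRingModule 𝔤 V] [LieModule K 𝔤 V]

lemma two_le_of_toMatrix_eq_of_trace_eq_zero {ι : Type*} [Fintype ι] [DecidableEq ι]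
    (hfaithful : Function.Injective (LieModule.toEnd K 𝔤 V)) (b : Module.Basis ι K V)
    {I : LieIdeal K 𝔤} (hI : I ≠ ⊥) {d : ℕ} (hd : 0 < d)
    (φ : Matrix (Fin d) (Fin d) K → Matrix ι ι K) (h0 : φ 0 = 0)
    (h : ∀ x ∈ I, ∃ X, X.trace = 0 ∧ LinearMap.toMatrix b b (LieModule.toEnd K 𝔤 V x) = φ X) :
    2 ≤ d := by
  by_contra hd2
  obtain rfl : d = 1 := by omega
  refine hI ((LieSubmodule.eq_bot_iff _).2 fun x hx => ?_)
  obtain ⟨X, hX, hx⟩ := h x hx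
  have hX0 : X = 0 := by
    ext i j
    rw [Matrix.trace_fin_one] at hX
    simpa [Subsingleton.elim i 0, Subsingleton.elim j 0] using hX
  rw [hX0, h0] at hx
  exact hfaithful (by simpa using hx)

lemma exists_basis_actsBySlProd [IsAlgClosed K] [CharZero K] [IsSemisimple K 𝔤]
    [FiniteDimensional K V] [LieModule.IsIrreducible K 𝔤 V]
    (hfaithful : Function.Injective (LieModule.toEnd K 𝔤 V)) {I : LieIdeal K 𝔤}
    (hbot : I ≠ ⊥) (htop : I ≠ ⊤) :
    ∃ (d k : ℕ) (b : Module.Basis (Fin d × Fin k) K V), 2 ≤ d ∧ 2 ≤ k ∧ ActsBySlProd K 𝔤 b := by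
  have hV : Nontrivial V := LieModule.nontrivial_of_isIrreducible K 𝔤 V
  have hdec (x : 𝔤) : ∃ y ∈ I, ∃ z ∈ Iᶜ, y + z = x :=
    (LieSubmodule.mem_sup _ _ x).1 (by rw [sup_compl_eq_top]; trivial)
  have hlie : ∀ y ∈ I, ∀ z ∈ Iᶜ, ⁅y, z⁆ = 0 := fun y hy z hz => by
    have h : ⁅I, Iᶜ⁆ ≤ ⊥ := (LieSubmodule.lie_le_inf I Iᶜ).trans inf_compl_eq_bot.le
    simpa using h (LieSubmodule.lie_mem_lie hy hz)
  obtain ⟨d, k, b, h1, h2⟩ := exists_basis_kronecker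
    (Set.image (LieModule.toEnd K 𝔤 V) I)
    (Set.image (LieModule.toEnd K 𝔤 V) (Iᶜ : LieIdeal K 𝔤))
    (by
      rintro _ ⟨y, hy, rfl⟩ _ ⟨z, hz, rfl⟩
      exact LinearMap.ext fun v => by simpa [hlie y hy z hz] using leibniz_lie y z v)
    (fun W hW1 hW2 => by
      let W' : LieSubmodule K 𝔤 V :=
        { W with
          lie_mem := fun {x m} hm => by
            obtain ⟨y, hy, z, hz, rfl⟩ := hdec x
            rw [add_lie]
            exact W.add_mem (hW1 _ ⟨y, hy, rfl⟩ hm) (hW2 _ ⟨z, hz, rfl⟩ hm) }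
      have := IsSimpleOrder.eq_bot_or_eq_top W'
      simpa [← LieSubmodule.toSubmodule_inj, W'] using this)
  obtain ⟨i, j⟩ := b.index_nonempty.some
  have hd := i.pos
  have hk := j.pos
  have h1' : ∀ y ∈ I, ∃ X : Matrix (Fin d) (Fin d) K, X.trace = 0 ∧
      LinearMap.toMatrix b b (LieModule.toEnd K 𝔤 V y) = X ⊗ₖ 1 := fun y hy => by
    obtain ⟨X, hX⟩ := h1 _ ⟨y, hy, rfl⟩
    have := IsSemisimple.trace_toEnd_eq_zero (K := K) V y
    rw [LinearMap.trace_eq_matrix_trace K b, hX, Matrix.trace_kronecker] at this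
    exact ⟨X, by simpa [hk.ne'] using this, hX⟩
  have h2' : ∀ z ∈ Iᶜ, ∃ Y : Matrix (Fin k) (Fin k) K, Y.trace = 0 ∧
      LinearMap.toMatrix b b (LieModule.toEnd K 𝔤 V z) = 1 ⊗ₖ Y := fun z hz => by
    obtain ⟨Y, hY⟩ := h2 _ ⟨z, hz, rfl⟩
    have := IsSemisimple.trace_toEnd_eq_zero (K := K) V z
    rw [LinearMap.trace_eq_matrix_trace K b, hY, Matrix.trace_kronecker] at this
    exact ⟨Y, by simpa [hd.ne'] using this, hY⟩
  refine ⟨d, k, b,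
    two_le_of_toMatrix_eq_of_trace_eq_zero hfaithful b hbot hd (· ⊗ₖ 1) (Matrix.zero_kronecker _) h1',
    two_le_of_toMatrix_eq_of_trace_eq_zero hfaithful b (compl_eq_bot.not.2 htop) hk (1 ⊗ₖ ·)
      (Matrix.kronecker_zero _) h2', fun x => ?_⟩
  obtain ⟨y, hy, z, hz, rfl⟩ := hdec x
  obtain ⟨X, hX, hX'⟩ := h1' y hy
  obtain ⟨Y, hY, hY'⟩ := h2' z hz
  exact ⟨X, Y, hX, hY, by rw [map_add, map_add, hX', hY']⟩

end LieAlgebra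

lemma Nat.not_isPrimePow_mul_of_coprime {d k : ℕ} (h : d.Coprime k) (hd : 2 ≤ d) (hk : 2 ≤ k) :
    ¬ IsPrimePow (d * k) := by
  intro hp
  obtain ⟨p, n, hp, -, hpn⟩ := (isPrimePow_nat_iff _).1 hp
  have key (m : ℕ) (hm : 2 ≤ m) (hmd : m ∣ d * k) : p ∣ m := by
    have hprime := Nat.minFac_prime (show m ≠ 1 by omega)
    have : m.minFac ∣ p ^ n := hpn ▸ (Nat.minFac_dvd m).trans hmd
    rw [← (Nat.prime_dvd_prime_iff_eq hprime hp).1 (hprime.dvd_of_dvd_pow this)]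
    exact Nat.minFac_dvd m
  exact Nat.not_coprime_of_dvd_of_dvd hp.one_lt (key d hd (dvd_mul_right _ _))
    (key k hk (dvd_mul_left _ _)) h

/-- Let `𝔤` be a finite-dimensional semisimple Lie algebra over an
algebraically closed field `K` of characteristic `0` and let `V` be a faithful irreducible
`𝔤`-module of dimension `r ≥ 2` such that `(V^{⊗n})^𝔤 = 0` for all `1 ≤ n < r`.
If moreover `dim_K (V^{⊗r})^𝔤 ≤ 3`, or `r` is a prime power, then `𝔤` is simple. -/
theorem lieAlgebra_isSimple_of_invariants
    (K : Type*) [Field K] [IsAlgClosed K] [CharZero K]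
    (𝔤 : Type*) [LieRing 𝔤] [LieAlgebra K 𝔤] [FiniteDimensional K 𝔤]
    [LieAlgebra.IsSemisimple K 𝔤]
    (V : Type*) [AddCommGroup V] [Module K V] [LieRingModule 𝔤 V] [LieModule K 𝔤 V]
    [FiniteDimensional K V] [LieModule.IsIrreducible K 𝔤 V]
    (hfaithful : Function.Injective (LieModule.toEnd K 𝔤 V))
    (r : ℕ) (hr : r = Module.finrank K V) (hr2 : 2 ≤ r)
    (hinv : ∀ n : ℕ, 1 ≤ n → n < r → tensorPowerInvariants K 𝔤 V n = ⊥)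
    (hextra : Module.finrank K (tensorPowerInvariants K 𝔤 V r) ≤ 3 ∨ IsPrimePow r) :
    LieAlgebra.IsSimple K 𝔤 := by
  have hnonab : ¬ IsLieAbelian 𝔤 := fun _ => by
    have := LieAlgebra.subsingleton_of_hasTrivialRadical_lie_abelian (R := K) (L := 𝔤)
    have h1 := hinv 1 le_rfl hr2
    have htop : tensorPowerInvariants K 𝔤 V 1 = ⊤ := by
      simp only [tensorPowerInvariants, iInf_eq_top]
      intro x
      rw [Subsingleton.elim x 0, LinearMap.ker_eq_top]
      simp [tensorPowerLieAction, ← PiTensorProduct.mapMultilinear_apply]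
    have := LieModule.nontrivial_of_isIrreducible K 𝔤 V
    let B := Basis.piTensorProduct fun _ : Fin 1 => Module.finBasis K V
    have : Nonempty (Fin 1 → Fin (Module.finrank K V)) := ⟨fun _ => ⟨0, by omega⟩⟩
    have := B.ne_zero (Classical.arbitrary _)
    exact this ((Submodule.mem_bot K).1 (h1 ▸ htop ▸ Submodule.mem_top))
  refine ⟨fun I => ?_, hnonab⟩
  by_contra! hI
  obtain ⟨d, k, b, hd, hk, hb⟩ := exists_basis_actsBySlProd hfaithful hI.1 hI.2
  obtain rfl : r = d * k := by simp [hr, Module.finrank_eq_card_basis b]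
  rcases hextra with h3 | hpp
  · have := four_le_finrank_invariants hb hd hk
    omega
  · exact Nat.not_isPrimePow_mul_of_coprime
      (coprime_of_invariants_eq_bot hb (by omega) (by omega) hinv) hd hk hpp
end

section
/- Let 𝔤 be a simple Lie algebra of type D_l with l ≥ 4 over an algebraically closed field K of characteristic 0 (concretely, 𝔤 ≅ so(2l, K)). Then for every finite-dimensional irreducible 𝔤-module V, the tensor square V ⊗ V contains a self-dual irreducible submodule, and consequently (V^{⊗4})^𝔤 ≠ 0. In particular, if r := dim V > 4, then V does not satisfy (V^{⊗n})^𝔤 = 0 for all 1 ≤ n < r. -/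
open scoped TensorProduct

/-- A spanning family of a Lie algebra obeying the relations of the elements
`E i j - E (n - 1 - j) (n - 1 - i)` of the orthogonal Lie algebra of the antidiagonal form, with
`n` even. -/
structure IsOrthogonalFamily (K : Type*) [Field K] {𝔤 : Type*} [LieRing 𝔤] [LieAlgebra K 𝔤]
    {n : ℕ} (F : Fin n → Fin n → 𝔤) : Prop where
  even : Even n
  span_eq_top : Submodule.span K (Set.range fun p : Fin n × Fin n ↦ F p.1 p.2) = ⊤
  neg_rev : ∀ i j, F i j = -F j.rev i.rev
  lie_eq : ∀ k l i j, ⁅F k l, F i j⁆ =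
    (if l = i then F k j else 0) - (if j = k then F i l else 0)
      - (if i = k.rev then F l.rev j else 0) + (if j = l.rev then F i k.rev else 0)

/-- The root `ε_a - ε_b` in the coordinates given by the elements `F i i`. -/
def orthogonalRoot {n : ℕ} (a b : Fin n) : Fin n → ℤ :=
  Pi.single a 1 - Pi.single b 1 - Pi.single a.rev 1 + Pi.single b.rev 1

/-- The monoid generated by the positive roots. -/
def orthogonalPosCone (n : ℕ) : AddSubmonoid (Fin n → ℤ) :=
  AddSubmonoid.closure {δ | ∃ a b : Fin n, a < b ∧ a ≠ b.rev ∧ orthogonalRoot a b = δ}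

/-- The subspace on which every `F i i` acts as the scalar `μ i`. -/
def orthogonalWeightSpace {K : Type*} [Field K] {𝔤 : Type*} [LieRing 𝔤] [LieAlgebra K 𝔤] {n : ℕ}
    (F : Fin n → Fin n → 𝔤) (M : Type*) [AddCommGroup M] [Module K M] [LieRingModule 𝔤 M]
    [LieModule K 𝔤 M] (μ : Fin n → K) : Submodule K M :=
  ⨅ i, (LieModule.toEnd K 𝔤 M (F i i)).eigenspace (μ i)

/-- A nonzero vector of weight `μ` killed by the positive root vectors. -/
structure IsOrthogonalHighest {K : Type*} [Field K] {𝔤 : Type*} [LieRing 𝔤] {n : ℕ}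
    (F : Fin n → Fin n → 𝔤) {M : Type*} [AddCommGroup M] [Module K M] [LieRingModule 𝔤 M]
    (μ : Fin n → K) (v : M) : Prop where
  ne_zero : v ≠ 0
  lie_diag : ∀ i, ⁅F i i, v⁆ = μ i • v
  lie_eq_zero : ∀ i j, i < j → ⁅F i j, v⁆ = 0

/-- The scalar by which the Casimir element acts on a highest weight vector of weight `μ`. -/
def orthogonalCasimirScalar {K : Type*} [Field K] {n : ℕ} (μ : Fin n → K) : K :=
  ∑ i, ∑ j, ((if i = j then μ i * μ i else 0) + if i < j ∧ i ≠ j.rev then μ i - μ j else 0)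

/-- The action of the Casimir element. -/
def orthogonalCasimir {𝔤 : Type*} [LieRing 𝔤] {n : ℕ}
    (F : Fin n → Fin n → 𝔤) {M : Type*} [AddCommGroup M] [LieRingModule 𝔤 M] (v : M) : M :=
  ∑ i, ∑ j, ⁅F i j, ⁅F j i, v⁆⁆

/-- The weights all of whose pairings with positive coroots are natural numbers. -/
def IsOrthogonalDominant {K : Type*} [Field K] {n : ℕ} (μ : Fin n → K) : Prop :=
  (∀ i, μ i.rev = -μ i) ∧ ∀ a b : Fin n, a < b → a ≠ b.rev → ∃ k : ℕ, μ a - μ b = k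

section RootCombinatorics

variable {K : Type*} [Field K] {n : ℕ}

lemma orthogonalRoot_sum_mul {R : Type*} [CommRing R] (a b : Fin n) (ν : Fin n → R) :
    ∑ i, (orthogonalRoot a b i : R) * ν i = ν a - ν b - ν a.rev + ν b.rev := by
  simp [orthogonalRoot, Pi.single_apply, add_mul, sub_mul, Finset.sum_add_distrib,
    Finset.sum_sub_distrib]

lemma Fin.rev_ne_self_of_even (hn : Even n) (a : Fin n) : a.rev ≠ a := by
  obtain ⟨m, rfl⟩ := hn
  intro h
  have := congrArg Fin.val h
  rw [Fin.val_rev] at this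
  omega

lemma orthogonalRoot_apply_left (hn : Even n) {a b : Fin n} (h : a ≠ b) (h' : a ≠ b.rev) :
    orthogonalRoot a b a = 1 := by
  simp [orthogonalRoot, h, h', (Fin.rev_ne_self_of_even hn a).symm]

lemma orthogonalRoot_apply_right (hn : Even n) {a b : Fin n} (h : a ≠ b) (h' : a ≠ b.rev) :
    orthogonalRoot a b b = -1 := by
  have : b ≠ a.rev := fun e ↦ h' (by rw [e, Fin.rev_rev])
  simp [orthogonalRoot, h.symm, this, (Fin.rev_ne_self_of_even hn b).symm]

/-- The sum of the differences of the coordinates of a weight over the positive roots. -/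
def orthogonalHeight (δ : Fin n → ℤ) : ℤ :=
  ∑ i, ∑ j, if i < j ∧ i ≠ j.rev then δ i - δ j else 0

lemma orthogonalHeight_eq (hn : Even n) (δ : Fin n → ℤ) :
    orthogonalHeight δ =
      ∑ i, δ i * ((n : ℤ) - 1 - 2 * i.val - if i < i.rev then 1 else -1) := by
  have h1 (i : Fin n) : ∑ j : Fin n, (if i < j ∧ i ≠ j.rev then (1 : ℤ) else 0)
      = (n : ℤ) - 1 - i.val - if i < i.rev then 1 else 0 := by
    have (j : Fin n) : (if i < j ∧ i ≠ j.rev then (1 : ℤ) else 0)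
        = (if i < j then 1 else 0) - if j = i.rev then (if i < i.rev then 1 else 0) else 0 := by
      rcases eq_or_ne j i.rev with rfl | h
      · simp
      · have : i ≠ j.rev := fun e ↦ h (by rw [e, Fin.rev_rev])
        simp [h, this]
    simp_rw [this, Finset.sum_sub_distrib]
    rw [← Finset.sum_filter, Finset.sum_const, Finset.filter_lt_eq_Ioi, Fin.card_Ioi]
    simp
    omega
  have h2 (i : Fin n) : ∑ j : Fin n, (if j < i ∧ j ≠ i.rev then (1 : ℤ) else 0)
      = i.val - if i < i.rev then 0 else 1 := by
    have (j : Fin n) : (if j < i ∧ j ≠ i.rev then (1 : ℤ) else 0)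
        = (if j < i then 1 else 0) - if j = i.rev then (if i < i.rev then 0 else 1) else 0 := by
      rcases eq_or_ne j i.rev with rfl | h
      · rcases lt_trichotomy i i.rev with h | h | h
        · simp [h, h.le]
        · exact absurd h.symm (Fin.rev_ne_self_of_even hn i)
        · simp [h, h.not_gt]
      · simp [h]
    simp_rw [this, Finset.sum_sub_distrib]
    rw [← Finset.sum_filter, Finset.sum_const, Finset.filter_gt_eq_Iio, Fin.card_Iio]
    simp
  have : orthogonalHeight δ = ∑ i, ∑ j, (δ i * (if i < j ∧ i ≠ j.rev then (1 : ℤ) else 0))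
      - ∑ i, ∑ j, (δ j * (if i < j ∧ i ≠ j.rev then (1 : ℤ) else 0)) := by
    simp_rw [orthogonalHeight, ← Finset.sum_sub_distrib]
    refine Finset.sum_congr rfl fun i _ ↦ Finset.sum_congr rfl fun j _ ↦ ?_
    split_ifs <;> simp
  rw [this, Finset.sum_comm (f := fun i j ↦ δ j * _)]
  simp_rw [← Finset.mul_sum, h1, h2, ← Finset.sum_sub_distrib, ← mul_sub]
  refine Finset.sum_congr rfl fun i _ ↦ ?_
  congr 1
  split_ifs <;> ring

lemma orthogonalHeight_root_pos (hn : Even n) {a b : Fin n} (hab : a < b) (h : a ≠ b.rev) :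
    0 < orthogonalHeight (orthogonalRoot a b) := by
  rw [orthogonalHeight_eq hn]
  have := orthogonalRoot_sum_mul a b
    fun i ↦ ((n : ℤ) - 1 - 2 * i.val - if i < i.rev then 1 else -1)
  simp only [Int.cast_id] at this
  rw [this]
  have ha := Fin.rev_ne_self_of_even hn a
  have hb := Fin.rev_ne_self_of_even hn b
  rw [Ne, Fin.ext_iff, Fin.val_rev] at h ha hb
  rw [Fin.lt_def] at hab
  simp only [Fin.rev_rev, Fin.lt_def, Fin.val_rev]
  split_ifs <;> omega

lemma orthogonalHeight_add (δ ε : Fin n → ℤ) :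
    orthogonalHeight (δ + ε) = orthogonalHeight δ + orthogonalHeight ε := by
  simp_rw [orthogonalHeight, ← Finset.sum_add_distrib]
  refine Finset.sum_congr rfl fun i _ ↦ Finset.sum_congr rfl fun j _ ↦ ?_
  split_ifs
  · simp only [Pi.add_apply]; ring
  · simp

lemma orthogonalHeight_zero : orthogonalHeight (0 : Fin n → ℤ) = 0 := by
  simp [orthogonalHeight]

lemma orthogonalHeight_pos_of_mem (hn : Even n) {δ : Fin n → ℤ} (hδ : δ ∈ orthogonalPosCone n) :
    δ = 0 ∨ 0 < orthogonalHeight δ := by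
  induction hδ using AddSubmonoid.closure_induction with
  | mem x hx =>
    obtain ⟨a, b, hab, h, rfl⟩ := hx
    exact .inr (orthogonalHeight_root_pos hn hab h)
  | zero => exact .inl rfl
  | add x y _ _ hx hy =>
    rw [orthogonalHeight_add]
    rcases hx with rfl | hx <;> rcases hy with rfl | hy
    · simp
    · right; rw [orthogonalHeight_zero]; omega
    · right; rw [orthogonalHeight_zero]; omega
    · right; omega

lemma IsOrthogonalDominant.exists_sum_mul_eq {μ : Fin n → K} (hμ : IsOrthogonalDominant μ)
    {δ : Fin n → ℤ} (hδ : δ ∈ orthogonalPosCone n) :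
    ∃ k : ℕ, ∑ i, (δ i : K) * μ i = k := by
  induction hδ using AddSubmonoid.closure_induction with
  | mem x hx =>
    obtain ⟨a, b, hab, h, rfl⟩ := hx
    obtain ⟨k, hk⟩ := hμ.2 a b hab h
    refine ⟨2 * k, ?_⟩
    rw [orthogonalRoot_sum_mul, hμ.1, hμ.1, Nat.cast_mul, ← hk]
    push_cast
    ring
  | zero => exact ⟨0, by simp⟩
  | add x y _ _ hx hy =>
    obtain ⟨k, hk⟩ := hx
    obtain ⟨m, hm⟩ := hy
    exact ⟨k + m, by simp [add_mul, Finset.sum_add_distrib, hk, hm]⟩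

/-- Two dominant weights with the same Casimir scalar which differ by a sum of positive roots are
equal. -/
lemma IsOrthogonalDominant.eq_zero_of_casimirScalar_eq [CharZero K] (hn : Even n)
    {μ : Fin n → K} {δ : Fin n → ℤ} (hδ : δ ∈ orthogonalPosCone n)
    (hμ : IsOrthogonalDominant μ) (hμ' : IsOrthogonalDominant fun i ↦ μ i - δ i)
    (h : orthogonalCasimirScalar μ = orthogonalCasimirScalar fun i ↦ μ i - δ i) : δ = 0 := by
  obtain ⟨k, hk⟩ := hμ.exists_sum_mul_eq hδ
  obtain ⟨m, hm⟩ := hμ'.exists_sum_mul_eq hδ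
  refine (orthogonalHeight_pos_of_mem hn hδ).resolve_right fun hpos ↦ ?_
  have key : orthogonalCasimirScalar μ - orthogonalCasimirScalar (fun i ↦ μ i - δ i)
      = k + m + (orthogonalHeight δ : K) := by
    have e : (orthogonalHeight δ : K)
        = ∑ i, ∑ j, if i < j ∧ i ≠ j.rev then (δ i : K) - δ j else 0 := by
      simp [orthogonalHeight, apply_ite]
    rw [← hk, ← hm, e]
    simp only [orthogonalCasimirScalar, Finset.sum_add_distrib, Finset.sum_ite_eq,
      Finset.mem_univ, if_true]
    have e₁ : ∑ i, μ i * μ i - ∑ i, (μ i - δ i) * (μ i - δ i)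
        = ∑ i, (δ i : K) * μ i + ∑ i, (δ i : K) * (μ i - δ i) := by
      rw [← Finset.sum_sub_distrib, ← Finset.sum_add_distrib]
      exact Finset.sum_congr rfl fun i _ ↦ by ring
    rw [add_sub_add_comm, e₁]
    congr 1
    rw [← Finset.sum_sub_distrib]
    refine Finset.sum_congr rfl fun i _ ↦ ?_
    rw [← Finset.sum_sub_distrib]
    refine Finset.sum_congr rfl fun j _ ↦ ?_
    split_ifs <;> ring
  rw [h, sub_self] at key
  have : (0 : ℤ) = k + m + orthogonalHeight δ := by exact_mod_cast key
  omega

end RootCombinatorics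

section Sl2

variable {K L M : Type*} [Field K] [CharZero K] [LieRing L] [LieAlgebra K L]
  [AddCommGroup M] [Module K M] [LieRingModule L M] [LieModule K L M] [FiniteDimensional K M]

lemma Module.End.exists_max_shift (T : Module.End K M) (S : ℤ → Submodule K M)
    {p c : K} (hc : c ≠ 0) (hS : ∀ k, ∀ v ∈ S k, T v = (p + c * k) • v) (h0 : S 0 ≠ ⊥) :
    ∃ a : ℕ, S a ≠ ⊥ ∧ ∀ b : ℕ, a < b → S b = ⊥ := by
  have hfin : {k : ℕ | S k ≠ ⊥}.Finite := by
    refine Set.Finite.of_finite_image (f := fun k : ℕ ↦ p + c * k)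
      ((Module.End.finite_hasEigenvalue T).subset ?_) ?_
    · rintro _ ⟨k, hk, rfl⟩
      obtain ⟨v, hv, hv0⟩ := Submodule.exists_mem_ne_zero_of_ne_bot hk
      refine Module.End.hasEigenvalue_of_hasEigenvector (x := v) ⟨?_, hv0⟩
      rw [Module.End.mem_eigenspace_iff, hS _ v hv]
      simp
    · intro x _ y _ h
      simpa [hc] using h
  obtain ⟨a, ha, ha'⟩ := hfin.exists_maximal ⟨0, by simpa using h0⟩
  refine ⟨a, ha, fun b hb ↦ ?_⟩
  by_contra hb'
  exact absurd (ha' hb' hb.le) (not_le.mpr hb)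

namespace IsSl2Triple

variable {h e f : L}

omit [FiniteDimensional K M] in
lemma HasPrimitiveVectorWith.pow_toEnd_f_ne_zero {t : IsSl2Triple h e f} {m : M} {N : ℕ}
    (P : t.HasPrimitiveVectorWith m (N : K)) {j : ℕ} (hj : j ≤ N) :
    (LieModule.toEnd K L M f ^ j) m ≠ 0 := by
  induction j with
  | zero => simpa using P.ne_zero
  | succ j ih =>
    intro h0
    have := P.lie_e_pow_succ_toEnd_f j
    rw [h0, lie_zero, eq_comm, smul_eq_zero] at this
    refine this.elim (fun h1 ↦ ?_) (ih (by omega))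
    rcases mul_eq_zero.mp h1 with h1 | h1
    · exact Nat.cast_add_one_ne_zero j h1
    · have : (N : K) = j := sub_eq_zero.mp h1
      have : N = j := by exact_mod_cast this
      omega

lemma exists_string (t : IsSl2Triple h e f) {p : K} (S : ℤ → Submodule K M)
    (hh : ∀ k, ∀ v ∈ S k, ⁅h, v⁆ = (p + 2 * k) • v)
    (he : ∀ k, ∀ v ∈ S k, ⁅e, v⁆ ∈ S (k + 1)) (hf : ∀ k, ∀ v ∈ S k, ⁅f, v⁆ ∈ S (k - 1))
    (h0 : S 0 ≠ ⊥) :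
    ∃ a N : ℕ, p + 2 * a = N ∧ ∀ j : ℕ, j ≤ N → S (a - j) ≠ ⊥ := by
  obtain ⟨a, ha, hmax⟩ := (LieModule.toEnd K L M h).exists_max_shift S two_ne_zero
    (by simpa using hh) h0
  obtain ⟨u, hu, hu0⟩ := Submodule.exists_mem_ne_zero_of_ne_bot ha
  have P : t.HasPrimitiveVectorWith u (p + 2 * a : K) := by
    refine ⟨hu0, by simpa using hh _ u hu, ?_⟩
    have h1 := he _ u hu
    have h2 := hmax (a + 1) (by omega)
    push_cast at h2
    rwa [h2, Submodule.mem_bot] at h1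
  obtain ⟨N, hN⟩ := P.exists_nat
  rw [hN] at P
  refine ⟨a, N, hN, fun j hj h ↦ P.pow_toEnd_f_ne_zero hj ?_⟩
  rw [← Submodule.mem_bot K, ← h]
  clear h hj
  induction j with
  | zero => simpa using hu
  | succ j ih =>
    rw [pow_succ', Module.End.mul_apply]
    have := hf _ _ ih
    rwa [sub_sub] at this

/-- The set of weights of a string for an `sl₂`-triple is stable under the reflection. -/
lemma exists_reflection (t : IsSl2Triple h e f) {p : K} (S : ℤ → Submodule K M)
    (hh : ∀ k, ∀ v ∈ S k, ⁅h, v⁆ = (p + 2 * k) • v)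
    (he : ∀ k, ∀ v ∈ S k, ⁅e, v⁆ ∈ S (k + 1)) (hf : ∀ k, ∀ v ∈ S k, ⁅f, v⁆ ∈ S (k - 1))
    (h0 : S 0 ≠ ⊥) :
    ∃ k : ℤ, p = -k ∧ S k ≠ ⊥ := by
  obtain ⟨a, N, hN, hS⟩ := t.exists_string S hh he hf h0
  obtain ⟨b, N', hN', hS'⟩ := t.symm.exists_string (p := -p) (fun k ↦ S (-k))
    (fun k v hv ↦ by
      rw [neg_lie, hh _ v hv, ← neg_smul]
      push_cast
      congr 1
      ring)
    (fun k v hv ↦ by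
      have := hf _ v hv
      rwa [neg_add'])
    (fun k v hv ↦ by
      have := he _ v hv
      rwa [neg_sub, sub_eq_add_neg, add_comm]) (by simpa using h0)
  have hp : p = ((N - 2 * a : ℤ) : K) := by
    push_cast
    linear_combination hN
  have hNN : (N : ℤ) + N' = 2 * a + 2 * b := by
    have : (N : K) + N' = 2 * a + 2 * b := by linear_combination -hN - hN'
    exact_mod_cast this
  refine ⟨2 * a - N, by rw [hp]; push_cast; ring, ?_⟩
  rcases le_or_gt a N with haN | haN
  · convert hS (N - a) (by omega) using 2
    omega
  · convert hS' (N' - b) (by omega) using 2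
    omega

end IsSl2Triple

end Sl2

namespace IsOrthogonalFamily

variable {K : Type*} [Field K] [CharZero K] {𝔤 : Type*} [LieRing 𝔤] [LieAlgebra K 𝔤]
  {n : ℕ} {F : Fin n → Fin n → 𝔤}

section

variable (hF : IsOrthogonalFamily K F)
include hF

lemma apply_rev (a : Fin n) : F a a.rev = 0 := by
  have h := hF.neg_rev a a.rev
  rw [Fin.rev_rev] at h
  have h2 : (2 : K) • F a a.rev = 0 := by
    rw [two_smul]
    nth_rewrite 1 [h]
    exact neg_add_cancel _
  exact (smul_eq_zero.mp h2).resolve_left two_ne_zero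

omit [CharZero K] in
lemma lie_diag (i a b : Fin n) : ⁅F i i, F a b⁆ = (orthogonalRoot a b i : K) • F a b := by
  rw [hF.lie_eq]
  have e1 : (if i = a then F i b else 0) = if i = a then F a b else 0 := by
    split_ifs with h <;> simp [h]
  have e2 : (if b = i then F a i else 0) = if i = b then F a b else 0 := by
    rcases eq_or_ne b i with rfl | h
    · simp
    · simp [h, h.symm]
  have e3 : (if a = i.rev then F i.rev b else 0) = if i = a.rev then F a b else 0 := by
    rcases eq_or_ne i a.rev with rfl | h
    · simp
    · have : a ≠ i.rev := fun e ↦ h (by rw [e, Fin.rev_rev])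
      simp [h, this]
  have e4 : (if b = i.rev then F a i.rev else 0) = if i = b.rev then F a b else 0 := by
    rcases eq_or_ne i b.rev with rfl | h
    · simp
    · have : b ≠ i.rev := fun e ↦ h (by rw [e, Fin.rev_rev])
      simp [h, this]
  rw [e1, e2, e3, e4]
  simp only [orthogonalRoot, Pi.add_apply, Pi.sub_apply, Pi.single_apply]
  push_cast
  simp only [add_smul, sub_smul, ite_smul, one_smul, zero_smul]

omit [CharZero K] in
lemma lie_diag_diag (i j : Fin n) : ⁅F i i, F j j⁆ = 0 := by
  rw [hF.lie_diag]
  simp [orthogonalRoot]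

omit [CharZero K] in
lemma isSl2Triple {a b : Fin n} (hab : a ≠ b) (hab' : a ≠ b.rev) (h0 : F a a - F b b ≠ 0) :
    IsSl2Triple (F a a - F b b) (F a b) (F b a) := by
  have hba' : b ≠ a.rev := fun e ↦ hab' (by rw [e, Fin.rev_rev])
  refine ⟨h0, ?_, ?_, ?_⟩
  · rw [hF.lie_eq]
    simp [hba', hab']
  · rw [sub_lie, hF.lie_diag, hF.lie_diag, orthogonalRoot_apply_left hF.even hab hab',
      orthogonalRoot_apply_right hF.even hab hab', ← sub_smul, ← Nat.cast_smul_eq_nsmul K]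
    norm_num
  · rw [sub_lie, hF.lie_diag, hF.lie_diag, orthogonalRoot_apply_left hF.even hab.symm hba',
      orthogonalRoot_apply_right hF.even hab.symm hba', ← sub_smul,
      ← Nat.cast_smul_eq_nsmul K, ← neg_smul]
    norm_num

end

variable {M : Type*} [AddCommGroup M] [Module K M] [LieRingModule 𝔤 M] [LieModule K 𝔤 M]

omit [CharZero K] in
lemma mem_weightSpace {μ : Fin n → K} {v : M} :
    v ∈ orthogonalWeightSpace F M μ ↔ ∀ i, ⁅F i i, v⁆ = μ i • v := by
  simp [orthogonalWeightSpace]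

section

variable (hF : IsOrthogonalFamily K F)
include hF

omit [CharZero K] in
lemma weight_rev {μ : Fin n → K} (h : orthogonalWeightSpace F M μ ≠ ⊥) (i : Fin n) :
    μ i.rev = -μ i := by
  obtain ⟨v, hv, hv0⟩ := Submodule.exists_mem_ne_zero_of_ne_bot h
  rw [mem_weightSpace] at hv
  have h1 := hv i.rev
  rw [hF.neg_rev, Fin.rev_rev, neg_lie, hv, ← neg_smul] at h1
  exact (smul_left_injective K hv0 h1).symm

omit [CharZero K] in
lemma lie_mem_weightSpace {μ : Fin n → K} {v : M} (hv : v ∈ orthogonalWeightSpace F M μ)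
    (a b : Fin n) :
    ⁅F a b, v⁆ ∈ orthogonalWeightSpace F M fun i ↦ μ i + orthogonalRoot a b i := by
  rw [mem_weightSpace] at hv ⊢
  intro i
  rw [leibniz_lie, hF.lie_diag, smul_lie, hv, lie_smul, add_smul, add_comm]

omit [CharZero K] in
lemma iSupIndep_weightSpace : iSupIndep (orthogonalWeightSpace (K := K) F M) := by
  have h := Module.End.independent_iInf_maxGenEigenspace_of_forall_mapsTo
    (fun i ↦ LieModule.toEnd K 𝔤 M (F i i)) fun i j φ ↦
      Module.End.mapsTo_maxGenEigenspace_of_comm (by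
        ext v
        simp [leibniz_lie (F j j) (F i i) v, hF.lie_diag_diag]) φ
  refine h.mono fun μ ↦ iInf_mono fun i ↦ ?_
  exact (Module.End.genEigenspace _ _).mono le_top

variable [FiniteDimensional K M]

lemma dominant {μ : Fin n → K} {v : M} (hv : IsOrthogonalHighest F μ v) :
    IsOrthogonalDominant μ := by
  refine ⟨hF.weight_rev (M := M) (Submodule.ne_bot_iff _ |>.mpr
    ⟨v, mem_weightSpace.mpr hv.lie_diag, hv.ne_zero⟩), fun a b hab hab' ↦ ?_⟩
  have hw : ⁅F a a - F b b, v⁆ = (μ a - μ b) • v := by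
    rw [sub_lie, hv.lie_diag, hv.lie_diag, sub_smul]
  rcases eq_or_ne (F a a - F b b) 0 with h0 | h0
  · rw [h0, zero_lie, eq_comm, smul_eq_zero] at hw
    exact ⟨0, by simpa using hw.resolve_right hv.ne_zero⟩
  · have P : (hF.isSl2Triple hab.ne hab' h0).HasPrimitiveVectorWith v (μ a - μ b) :=
      ⟨hv.ne_zero, hw, hv.lie_eq_zero a b hab⟩
    exact P.exists_nat

/-- The set of weights is stable under reflections. -/
lemma weightSpace_reflection_ne_bot {μ : Fin n → K} (h : orthogonalWeightSpace F M μ ≠ ⊥)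
    {a b : Fin n} (hab : a ≠ b) (hab' : a ≠ b.rev) :
    orthogonalWeightSpace F M (fun i ↦ μ i - (μ a - μ b) * orthogonalRoot a b i) ≠ ⊥ := by
  let S (k : ℤ) : Submodule K M :=
    orthogonalWeightSpace F M fun i ↦ μ i + k * orthogonalRoot a b i
  have hba : orthogonalRoot b a = -orthogonalRoot a b := by
    simp only [orthogonalRoot]
    abel
  have S0 : S 0 ≠ ⊥ := by simpa [S] using h
  have hh (k : ℤ) (v : M) (hv : v ∈ S k) : ⁅F a a - F b b, v⁆ = ((μ a - μ b) + 2 * k) • v := by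
    rw [mem_weightSpace] at hv
    rw [sub_lie, hv, hv, ← sub_smul, orthogonalRoot_apply_left hF.even hab hab',
      orthogonalRoot_apply_right hF.even hab hab']
    congr 1
    push_cast
    ring
  suffices ∃ k : ℤ, μ a - μ b = -k ∧ S k ≠ ⊥ by
    obtain ⟨k, hk, hS⟩ := this
    convert hS using 4
    rw [hk]
    ring
  rcases eq_or_ne (F a a - F b b) 0 with h0 | h0
  · refine ⟨0, ?_, S0⟩
    obtain ⟨v, hv, hv0⟩ := Submodule.exists_mem_ne_zero_of_ne_bot S0
    have := hh 0 v hv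
    rw [h0, zero_lie, eq_comm, smul_eq_zero] at this
    simpa using this.resolve_right hv0
  · refine (hF.isSl2Triple hab hab' h0).exists_reflection S hh ?_ ?_ S0
    · intro k v hv
      convert hF.lie_mem_weightSpace hv a b using 3
      push_cast
      ring
    · intro k v hv
      convert hF.lie_mem_weightSpace hv b a using 3
      rw [hba]
      push_cast [Pi.neg_apply]
      ring

/-- The set of weights is stable under changing the signs of two coordinates. -/
lemma weightSpace_flip_ne_bot {μ : Fin n → K} (h : orthogonalWeightSpace F M μ ≠ ⊥)
    {a b : Fin n} (hab : a ≠ b) (hab' : a ≠ b.rev) :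
    orthogonalWeightSpace F M (fun i ↦ if i = a ∨ i = b ∨ i = a.rev ∨ i = b.rev
      then -μ i else μ i) ≠ ⊥ := by
  have h1 := hF.weightSpace_reflection_ne_bot h hab hab'
  have h2 := hF.weightSpace_reflection_ne_bot h1 hab' (by rwa [Fin.rev_rev])
  have hr := hF.weight_rev h
  convert h2 using 2
  funext i
  have hba' : b ≠ a.rev := fun e ↦ hab' (by rw [e, Fin.rev_rev])
  have ha := Fin.rev_ne_self_of_even hF.even a
  have hb := Fin.rev_ne_self_of_even hF.even b
  have hrev : a.rev ≠ b.rev := by simpa using hab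
  have hra := hr a
  have hrb := hr b
  clear h h1 h2 hr
  simp only [orthogonalRoot, Pi.add_apply, Pi.sub_apply, Pi.single_apply, Fin.rev_rev]
  push_cast
  grind

/-- If the rank is even then the set of weights is stable under negation. -/
lemma weightSpace_neg_ne_bot {m : ℕ} (hm : n = 4 * m) {μ : Fin n → K}
    (h : orthogonalWeightSpace F M μ ≠ ⊥) : orthogonalWeightSpace F M (fun i ↦ -μ i) ≠ ⊥ := by
  suffices H : ∀ j ≤ m, orthogonalWeightSpace F M (fun i ↦ if i.val < 2 * j ∨ i.rev.val < 2 * j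
      then -μ i else μ i) ≠ ⊥ by
    convert H m le_rfl using 3 with i
    rw [if_pos]
    rw [Fin.val_rev]
    omega
  intro j hj
  induction j with
  | zero => simpa using h
  | succ j ih =>
    have h1 := ih (by omega)
    have h2 := hF.weightSpace_flip_ne_bot h1 (a := ⟨2 * j, by omega⟩) (b := ⟨2 * j + 1, by omega⟩)
      (by simp) (by rw [Ne, Fin.ext_iff, Fin.val_rev]; simp only; omega)
    convert h2 using 3 with i
    simp only [Fin.ext_iff, Fin.val_rev]
    split_ifs <;> first | rfl | omega

end

end IsOrthogonalFamily

section Casimir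

namespace IsOrthogonalFamily

variable {K : Type*} [Field K] {𝔤 : Type*} [LieRing 𝔤] [LieAlgebra K 𝔤]
  {n : ℕ} {F : Fin n → Fin n → 𝔤} (hF : IsOrthogonalFamily K F)
  {M : Type*} [AddCommGroup M] [Module K M] [LieRingModule 𝔤 M] [LieModule K 𝔤 M]

include hF

omit [Module K M] [LieModule K 𝔤 M] in
lemma lie_apply_casimir (k l : Fin n) (v : M) :
    ⁅F k l, orthogonalCasimir F v⁆ = orthogonalCasimir F ⁅F k l, v⁆ := by
  have ite_lie (p : Prop) [Decidable p] (x : 𝔤) (w : M) :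
      ⁅if p then x else 0, w⁆ = if p then ⁅x, w⁆ else 0 := by split_ifs <;> simp
  have lie_ite (p : Prop) [Decidable p] (x : 𝔤) (w : M) :
      ⁅x, if p then w else 0⁆ = if p then ⁅x, w⁆ else 0 := by split_ifs <;> simp
  have sum_left (A : Fin n → Fin n → M) (a : Fin n) :
      ∑ i, ∑ j, (if i = a then A i j else 0) = ∑ j, A a j := by
    rw [Finset.sum_comm]
    simp
  have sum_right (A : Fin n → Fin n → M) (a : Fin n) :
      ∑ i, ∑ j, (if j = a then A i j else 0) = ∑ i, A i a := by
    simp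
  simp only [orthogonalCasimir, lie_sum]
  have h (i j : Fin n) : ⁅F k l, ⁅F i j, ⁅F j i, v⁆⁆⁆ = ⁅⁅F k l, F i j⁆, ⁅F j i, v⁆⁆ +
      ⁅F i j, ⁅⁅F k l, F j i⁆, v⁆⁆ + ⁅F i j, ⁅F j i, ⁅F k l, v⁆⁆⁆ := by
    rw [leibniz_lie, leibniz_lie (F k l) (F j i) v, lie_add, add_assoc]
  simp only [h, hF.lie_eq, add_lie, sub_lie, lie_add, lie_sub, ite_lie, lie_ite, eq_comm (a := l),
    Finset.sum_add_distrib, Finset.sum_sub_distrib, sum_left, sum_right]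
  abel

lemma lie_casimir (x : 𝔤) (v : M) :
    ⁅x, orthogonalCasimir F v⁆ = orthogonalCasimir F ⁅x, v⁆ := by
  have hx : x ∈ Submodule.span K (Set.range fun p : Fin n × Fin n ↦ F p.1 p.2) := by
    rw [hF.span_eq_top]
    trivial
  induction hx using Submodule.span_induction with
  | mem x hx =>
    obtain ⟨p, rfl⟩ := hx
    exact hF.lie_apply_casimir _ _ v
  | zero => simp [orthogonalCasimir]
  | add x y _ _ hx hy =>
    rw [add_lie, hx, hy]
    simp [orthogonalCasimir, Finset.sum_add_distrib]
  | smul c x _ hx =>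
    rw [smul_lie, hx]
    simp [orthogonalCasimir, Finset.smul_sum]

/-- The Casimir element as an equivariant endomorphism. -/
def casimirHom : M →ₗ⁅K,𝔤⁆ M where
  toFun := orthogonalCasimir F
  map_add' v w := by simp [orthogonalCasimir, Finset.sum_add_distrib]
  map_smul' c v := by simp [orthogonalCasimir, Finset.smul_sum]
  map_lie' {x v} := (hF.lie_casimir x v).symm

lemma casimir_highest [CharZero K] {μ : Fin n → K} {v : M} (hv : IsOrthogonalHighest F μ v) :
    orthogonalCasimir F v = orthogonalCasimirScalar μ • v := by
  simp only [orthogonalCasimir, orthogonalCasimirScalar, Finset.sum_smul]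
  refine Finset.sum_congr rfl fun i _ ↦ Finset.sum_congr rfl fun j _ ↦ ?_
  rcases lt_trichotomy i j with h | rfl | h
  · rcases eq_or_ne i j.rev with rfl | h'
    · have := hF.apply_rev j.rev
      rw [Fin.rev_rev] at this
      simp [this, h.ne]
    · have h'' : j ≠ i.rev := fun e ↦ h' (by rw [e, Fin.rev_rev])
      have e : ⁅F i j, F j i⁆ = F i i - F j j := by
        rw [hF.lie_eq]
        simp [h', h'']
      rw [leibniz_lie, hv.lie_eq_zero _ _ h, e, sub_lie, hv.lie_diag, hv.lie_diag]
      simp [h, h.ne, h', sub_smul]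
  · simp [hv.lie_diag, mul_smul]
  · simp [hv.lie_eq_zero _ _ h, h.ne', h.not_gt]

end IsOrthogonalFamily

lemma orthogonalCasimir_dual_apply {K : Type*} [Field K] {𝔤 : Type*} [LieRing 𝔤]
    [LieAlgebra K 𝔤] {n : ℕ} (F : Fin n → Fin n → 𝔤)
    {M : Type*} [AddCommGroup M] [Module K M] [LieRingModule 𝔤 M] [LieModule K 𝔤 M]
    (f : Module.Dual K M) (v : M) :
    orthogonalCasimir F f v = f (orthogonalCasimir F v) := by
  simp only [orthogonalCasimir, map_sum, LinearMap.sum_apply, Module.Dual.lie_apply, neg_neg]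
  exact Finset.sum_comm

end Casimir

section HighestWeight

variable {K : Type*} [Field K] [CharZero K] {𝔤 : Type*} [LieRing 𝔤] [LieAlgebra K 𝔤]
  {n : ℕ} {F : Fin n → Fin n → 𝔤} (hF : IsOrthogonalFamily K F)
  {M : Type*} [AddCommGroup M] [Module K M] [LieRingModule 𝔤 M] [LieModule K 𝔤 M]
  [FiniteDimensional K M]

omit [CharZero K] in
lemma Module.End.exists_iInf_eigenspace_ne_bot [IsAlgClosed K] [Nontrivial M] {ι : Type*}
    [Finite ι] (T : ι → Module.End K M) (hT : ∀ i j, Commute (T i) (T j)) :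
    ∃ μ : ι → K, ⨅ i, (T i).eigenspace (μ i) ≠ ⊥ := by
  cases nonempty_fintype ι
  suffices H : ∀ s : Finset ι, ∃ μ : ι → K, ⨅ i ∈ s, (T i).eigenspace (μ i) ≠ ⊥ by
    simpa using H Finset.univ
  classical
  intro s
  induction s using Finset.induction_on with
  | empty => exact ⟨0, by simp⟩
  | insert j s hj ih =>
    obtain ⟨μ, hμ⟩ := ih
    have hP : ∀ v ∈ ⨅ i ∈ s, (T i).eigenspace (μ i), T j v ∈ ⨅ i ∈ s, (T i).eigenspace (μ i) := by
      intro v hv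
      simp only [Submodule.mem_iInf, Module.End.mem_eigenspace_iff] at hv ⊢
      intro i hi
      rw [← Module.End.mul_apply, (hT i j).eq, Module.End.mul_apply, hv i hi, map_smul]
    have := Submodule.nontrivial_iff_ne_bot.mpr hμ
    obtain ⟨c, hc⟩ := Module.End.exists_eigenvalue ((T j).restrict hP)
    obtain ⟨v, hv⟩ := hc.exists_hasEigenvector
    refine ⟨Function.update μ j c, (Submodule.ne_bot_iff _).mpr ⟨v, ?_, by simpa using hv.2⟩⟩
    have hv1 := hv.apply_eq_smul
    have hv2 := v.2
    rw [Subtype.ext_iff] at hv1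
    simp only [Submodule.mem_iInf, Module.End.mem_eigenspace_iff] at hv2 ⊢
    intro i hi
    rcases eq_or_ne i j with rfl | hij
    · simpa using hv1
    · simpa [hij] using hv2 i ((Finset.mem_insert.mp hi).resolve_left hij)

include hF

/-- Every nontrivial module has a highest weight vector. -/
lemma IsOrthogonalFamily.exists_highest [IsAlgClosed K] (M : Type*) [AddCommGroup M] [Module K M]
    [LieRingModule 𝔤 M] [LieModule K 𝔤 M] [FiniteDimensional K M] [Nontrivial M] :
    ∃ (μ : Fin n → K) (v : M), IsOrthogonalHighest F μ v := by
  obtain ⟨μ, hμ⟩ : ∃ μ : Fin n → K, orthogonalWeightSpace F M μ ≠ ⊥ :=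
    Module.End.exists_iInf_eigenspace_ne_bot _ fun i j ↦ by
      ext v
      simp [leibniz_lie (F i i) (F j j) v, hF.lie_diag_diag]
  let ν (δ : Fin n → ℤ) : Fin n → K := fun i ↦ μ i + δ i
  have hν : Function.Injective ν := fun δ δ' h ↦ by
    funext i
    simpa [ν] using congrFun h i
  have hfin : {δ | orthogonalWeightSpace F M (ν δ) ≠ ⊥}.Finite :=
    (WellFoundedGT.finite_ne_bot_of_iSupIndep (hF.iSupIndep_weightSpace (M := M))).preimage
      hν.injOn
  obtain ⟨δ, hδ, hmax⟩ := Set.exists_max_image _ orthogonalHeight hfin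
    ⟨0, by simpa [ν] using hμ⟩
  obtain ⟨v, hv, hv0⟩ := Submodule.exists_mem_ne_zero_of_ne_bot hδ
  refine ⟨ν δ, v, hv0, IsOrthogonalFamily.mem_weightSpace.mp hv, fun a b hab ↦ ?_⟩
  rcases eq_or_ne a b.rev with rfl | hab'
  · have := hF.apply_rev b.rev
    rw [Fin.rev_rev] at this
    rw [this, zero_lie]
  · have h := hF.lie_mem_weightSpace hv a b
    by_contra hne
    have h2 := hmax (δ + orthogonalRoot a b) ((Submodule.ne_bot_iff _).mpr ⟨_, ?_, hne⟩)
    · have := orthogonalHeight_root_pos hF.even hab hab'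
      rw [orthogonalHeight_add] at h2
      omega
    · convert h using 3
      simp [ν, add_assoc]

end HighestWeight

section Generated

variable {K : Type*} [Field K] [CharZero K] {𝔤 : Type*} [LieRing 𝔤] [LieAlgebra K 𝔤]
  {n : ℕ} {F : Fin n → Fin n → 𝔤}
  {M : Type*} [AddCommGroup M] [Module K M] [LieRingModule 𝔤 M] [LieModule K 𝔤 M]

/-- The vectors obtained from `v` by repeatedly applying negative root vectors, with the amount by
which the weight has been lowered. -/
inductive IsOrthogonalDescendant {𝔤 : Type*} [LieRing 𝔤] {n : ℕ} (F : Fin n → Fin n → 𝔤)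
    {M : Type*} [AddCommGroup M] [LieRingModule 𝔤 M] (v : M) : (Fin n → ℤ) → M → Prop
  | refl : IsOrthogonalDescendant F v 0 v
  | step {δ : Fin n → ℤ} {w : M} {a b : Fin n} (hab : a < b) (hab' : a ≠ b.rev)
      (h : IsOrthogonalDescendant F v δ w) :
      IsOrthogonalDescendant F v (δ + orthogonalRoot a b) ⁅F b a, w⁆

lemma orthogonalRoot_swap (a b : Fin n) : orthogonalRoot b a = -orthogonalRoot a b := by
  simp only [orthogonalRoot]
  abel

namespace IsOrthogonalDescendant

lemma mem_cone {v w : M} {δ : Fin n → ℤ} (h : IsOrthogonalDescendant F v δ w) :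
    δ ∈ orthogonalPosCone n := by
  induction h with
  | refl => exact zero_mem _
  | step hab hab' _ ih => exact add_mem ih (AddSubmonoid.subset_closure ⟨_, _, hab, hab', rfl⟩)

lemma eq_of_eq_zero (hn : Even n) {v w : M} (h : IsOrthogonalDescendant F v 0 w) : w = v := by
  generalize hδ : (0 : Fin n → ℤ) = δ at h
  induction h with
  | refl => rfl
  | step hab hab' h _ =>
    have h1 := orthogonalHeight_root_pos hn hab hab'
    have h2 := congrArg orthogonalHeight hδ
    rw [orthogonalHeight_add, orthogonalHeight_zero] at h2
    rcases orthogonalHeight_pos_of_mem hn h.mem_cone with h3 | h3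
    · rw [h3, orthogonalHeight_zero] at h2
      omega
    · omega

omit [CharZero K] in
lemma mem_weightSpace (hF : IsOrthogonalFamily K F) {μ : Fin n → K} {v w : M}
    (hv : v ∈ orthogonalWeightSpace F M μ) {δ : Fin n → ℤ}
    (h : IsOrthogonalDescendant F v δ w) :
    w ∈ orthogonalWeightSpace F M fun i ↦ μ i - δ i := by
  induction h with
  | refl => simpa using hv
  | @step δ w a b _ _ _ ih =>
    convert hF.lie_mem_weightSpace ih b a using 3
    rw [orthogonalRoot_swap a b]
    simp only [Pi.add_apply, Pi.neg_apply]
    push_cast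
    ring

end IsOrthogonalDescendant

namespace IsOrthogonalFamily

variable (hF : IsOrthogonalFamily K F)
include hF

lemma lie_mem_span_descendant {μ : Fin n → K} {v : M} (hv : IsOrthogonalHighest F μ v)
    {δ : Fin n → ℤ} {w : M} (h : IsOrthogonalDescendant F v δ w) (x : 𝔤) :
    ⁅x, w⁆ ∈ Submodule.span K {w | ∃ δ, IsOrthogonalDescendant F v δ w} := by
  set S := Submodule.span K {w | ∃ δ, IsOrthogonalDescendant F v δ w}
  induction h generalizing x with
  | refl =>
    have hx : x ∈ Submodule.span K (Set.range fun p : Fin n × Fin n ↦ F p.1 p.2) := by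
      rw [hF.span_eq_top]
      trivial
    induction hx using Submodule.span_induction with
    | mem x hx =>
      obtain ⟨⟨i, j⟩, rfl⟩ := hx
      dsimp only
      rcases lt_trichotomy i j with h | rfl | h
      · rw [hv.lie_eq_zero _ _ h]
        exact zero_mem _
      · rw [hv.lie_diag]
        exact S.smul_mem _ (Submodule.subset_span ⟨0, .refl⟩)
      · rcases eq_or_ne j i.rev with rfl | h'
        · rw [hF.apply_rev, zero_lie]
          exact zero_mem _
        · exact Submodule.subset_span ⟨_, .step h h' .refl⟩
    | zero => simp
    | add x y _ _ hx hy =>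
      rw [add_lie]
      exact add_mem hx hy
    | smul c x _ hx =>
      rw [smul_lie]
      exact S.smul_mem _ hx
  | @step δ w a b hab hab' h ih =>
    rw [leibniz_lie]
    refine add_mem (ih _) ?_
    have hS : S ≤ S.comap (LieModule.toEnd K 𝔤 M (F b a)) := by
      rw [Submodule.span_le]
      rintro _ ⟨δ, h⟩
      exact Submodule.subset_span ⟨_, h.step hab hab'⟩
    exact hS (ih x)

lemma lieSpan_le_span_descendant {μ : Fin n → K} {v : M} (hv : IsOrthogonalHighest F μ v) :
    (LieSubmodule.lieSpan K 𝔤 {v}).toSubmodule ≤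
      Submodule.span K {w | ∃ δ, IsOrthogonalDescendant F v δ w} := by
  let S : LieSubmodule K 𝔤 M :=
    { Submodule.span K {w | ∃ δ, IsOrthogonalDescendant F v δ w} with
      lie_mem := fun {x m} hm ↦ by
        simp only [AddSubsemigroup.mem_carrier, AddSubmonoid.mem_toSubsemigroup,
          Submodule.mem_toAddSubmonoid] at hm ⊢
        induction hm using Submodule.span_induction with
        | mem w hw =>
          obtain ⟨δ, hw⟩ := hw
          exact hF.lie_mem_span_descendant hv hw x
        | zero => simp
        | add w w' _ _ h h' =>
          rw [lie_add]
          exact add_mem h h'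
        | smul c w _ h =>
          rw [lie_smul]
          exact Submodule.smul_mem _ _ h }
  have : LieSubmodule.lieSpan K 𝔤 {v} ≤ S := by
    rw [LieSubmodule.lieSpan_le, Set.singleton_subset_iff]
    exact Submodule.subset_span ⟨0, .refl⟩
  exact this

/-- The weights of a module generated by a highest weight vector. -/
lemma exists_of_mem_lieSpan {lam μ : Fin n → K} {v u : M} (hv : IsOrthogonalHighest F lam v)
    (hu : u ∈ LieSubmodule.lieSpan K 𝔤 {v}) (hu' : u ∈ orthogonalWeightSpace F M μ) (hu0 : u ≠ 0) :
    ∃ δ ∈ orthogonalPosCone n, (μ = fun i ↦ lam i - δ i) ∧ (δ = 0 → u ∈ K ∙ v) := by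
  set A : Set (Fin n → K) := {ν | ∃ δ ∈ orthogonalPosCone n, δ ≠ 0 ∧ ν = fun i ↦ lam i - δ i}
  have hv' : v ∈ orthogonalWeightSpace F M lam := mem_weightSpace.mpr hv.lie_diag
  have hu1 : u ∈ (K ∙ v) ⊔ ⨆ ν ∈ A, orthogonalWeightSpace F M ν := by
    refine (Submodule.span_le.mpr ?_) (hF.lieSpan_le_span_descendant hv hu)
    rintro w ⟨δ, hw⟩
    rcases eq_or_ne δ 0 with rfl | hδ
    · rw [hw.eq_of_eq_zero hF.even]
      exact Submodule.mem_sup_left (Submodule.mem_span_singleton_self v)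
    · exact Submodule.mem_sup_right (le_biSup (orthogonalWeightSpace F M)
        (show _ ∈ A from ⟨δ, hw.mem_cone, hδ, rfl⟩) (hw.mem_weightSpace hF hv'))
  obtain ⟨y, hy, z, hz, rfl⟩ := Submodule.mem_sup.mp hu1
  have hy' : y ∈ orthogonalWeightSpace F M lam :=
    (Submodule.span_singleton_le_iff_mem _ _).mpr hv' hy
  by_cases hμA : μ ∈ A
  · obtain ⟨δ, hδ, h0, rfl⟩ := hμA
    exact ⟨δ, hδ, rfl, fun h ↦ absurd h h0⟩
  have hind := hF.iSupIndep_weightSpace (M := M)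
  have hlam : μ = lam := by
    by_contra hne
    have h1 : y + z ∈ ⨆ ν ∈ insert lam A, orthogonalWeightSpace F M ν := by
      rw [iSup_insert]
      exact add_mem (Submodule.mem_sup_left hy') (Submodule.mem_sup_right hz)
    exact hu0 (Submodule.disjoint_def.mp (hind.disjoint_biSup (x := μ) (y := insert lam A)
      (by simp [hne, hμA])) _ hu' h1)
  subst hlam
  have hz' : z ∈ orthogonalWeightSpace F M μ := by simpa using sub_mem hu' hy'
  have : z = 0 := Submodule.disjoint_def.mp (hind.disjoint_biSup hμA) _ hz' hz
  refine ⟨0, zero_mem _, by simp, fun _ ↦ ?_⟩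
  rwa [this, add_zero]

lemma casimir_of_mem_lieSpan {lam : Fin n → K} {v u : M} (hv : IsOrthogonalHighest F lam v)
    (hu : u ∈ LieSubmodule.lieSpan K 𝔤 {v}) :
    orthogonalCasimir F u = orthogonalCasimirScalar lam • u := by
  have h : LieSubmodule.lieSpan K 𝔤 {v} ≤
      (hF.casimirHom (M := M) - orthogonalCasimirScalar lam • LieModuleHom.id).ker := by
    rw [LieSubmodule.lieSpan_le, Set.singleton_subset_iff, SetLike.mem_coe, LieModuleHom.mem_ker]
    exact sub_eq_zero.mpr (hF.casimir_highest hv)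
  exact sub_eq_zero.mp (LieModuleHom.mem_ker.mp (h hu))

variable [FiniteDimensional K M]

lemma highest_mem_span_singleton {lam μ : Fin n → K} {v u : M} (hv : IsOrthogonalHighest F lam v)
    (hu : u ∈ LieSubmodule.lieSpan K 𝔤 {v}) (hu' : IsOrthogonalHighest F μ u) : u ∈ K ∙ v := by
  obtain ⟨δ, hδ, rfl, h⟩ := hF.exists_of_mem_lieSpan hv hu (mem_weightSpace.mpr hu'.lie_diag)
    hu'.ne_zero
  refine h ((hF.dominant hv).eq_zero_of_casimirScalar_eq hF.even hδ (hF.dominant hu') ?_)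
  refine smul_left_injective K hu'.ne_zero ?_
  simp only
  rw [← hF.casimir_highest hu', ← hF.casimir_of_mem_lieSpan hv hu]

variable [IsAlgClosed K]

lemma exists_highest_mem (N : LieSubmodule K 𝔤 M) (hN : N ≠ ⊥) :
    ∃ (μ : Fin n → K) (u : M), u ∈ N ∧ IsOrthogonalHighest F μ u := by
  have := (LieSubmodule.nontrivial_iff_ne_bot K 𝔤 M).mpr hN
  obtain ⟨μ, u, hu⟩ := hF.exists_highest N
  refine ⟨μ, u, u.2, by simpa using hu.ne_zero, fun i ↦ ?_, fun i j hij ↦ ?_⟩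
  · simpa using congrArg N.subtype (hu.lie_diag i)
  · simpa using congrArg N.subtype (hu.lie_eq_zero i j hij)

/-- A finite-dimensional module generated by a highest weight vector is irreducible. -/
theorem isIrreducible_lieSpan {lam : Fin n → K} {v : M} (hv : IsOrthogonalHighest F lam v) :
    LieModule.IsIrreducible K 𝔤 (LieSubmodule.lieSpan K 𝔤 {v}) := by
  set N := LieSubmodule.lieSpan K 𝔤 {v}
  have hvN : v ∈ N := LieSubmodule.subset_lieSpan rfl
  have : Nontrivial N := ⟨⟨v, hvN⟩, 0, by simpa [Subtype.ext_iff] using hv.ne_zero⟩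
  refine LieModule.IsIrreducible.mk fun P hP ↦ ?_
  have hP' : P.map N.incl ≠ ⊥ := by
    refine fun h ↦ hP ((LieSubmodule.eq_bot_iff _).mpr fun x hx ↦ ?_)
    simpa using h.le (LieSubmodule.mem_map_of_mem (f := N.incl) hx)
  obtain ⟨μ, u, hu, hu'⟩ := hF.exists_highest_mem _ hP'
  obtain ⟨u, huP, rfl⟩ := (LieSubmodule.mem_map _).mp hu
  obtain ⟨c, hc⟩ := Submodule.mem_span_singleton.mp (hF.highest_mem_span_singleton hv u.2 hu')
  change c • v = N.incl u at hc
  have hc0 : c ≠ 0 := by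
    rintro rfl
    exact hu'.ne_zero (by rw [← hc, zero_smul])
  have hvP : N ≤ P.map N.incl := by
    rw [LieSubmodule.lieSpan_le, Set.singleton_subset_iff]
    rw [SetLike.mem_coe, ← inv_smul_smul₀ hc0 v, hc]
    exact (P.map N.incl).smul_mem c⁻¹ hu
  rw [eq_top_iff]
  intro x _
  obtain ⟨y, hy, hxy⟩ := (LieSubmodule.mem_map _).mp (hvP x.2)
  rwa [← Subtype.ext hxy]

end IsOrthogonalFamily

end Generated

section Prod

variable {K : Type*} [CommRing K] {𝔤 : Type*} [LieRing 𝔤] [LieAlgebra K 𝔤]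
  {M N : Type*} [AddCommGroup M] [Module K M] [LieRingModule 𝔤 M] [LieModule K 𝔤 M]
  [AddCommGroup N] [Module K N] [LieRingModule 𝔤 N] [LieModule K 𝔤 N]

/-- The product of two modules, with the componentwise action. -/
instance Prod.instLieRingModuleComponentwise : LieRingModule 𝔤 (M × N) where
  bracket x p := (⁅x, p.1⁆, ⁅x, p.2⁆)
  add_lie x y p := by simp
  lie_add x p q := by simp
  leibniz_lie x y p := by simp

lemma Prod.lie_mk (x : 𝔤) (m : M) (n : N) : ⁅x, (m, n)⁆ = (⁅x, m⁆, ⁅x, n⁆) := rfl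

instance Prod.instLieModuleComponentwise : LieModule K 𝔤 (M × N) where
  smul_lie c x p := by
    obtain ⟨m, n⟩ := p
    simp [Prod.lie_mk]
  lie_smul c x p := by
    obtain ⟨m, n⟩ := p
    simp [Prod.lie_mk]

variable (K 𝔤 M N)

/-- The first projection as a homomorphism of modules. -/
def LieModuleHom.prodFst : M × N →ₗ⁅K,𝔤⁆ M := { LinearMap.fst K M N with map_lie' := rfl }

/-- The second projection as a homomorphism of modules. -/
def LieModuleHom.prodSnd : M × N →ₗ⁅K,𝔤⁆ N := { LinearMap.snd K M N with map_lie' := rfl }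

end Prod

section Schur

variable {K : Type*} [Field K] {𝔤 : Type*} [LieRing 𝔤] [LieAlgebra K 𝔤]
  {M N : Type*} [AddCommGroup M] [Module K M] [LieRingModule 𝔤 M] [LieModule K 𝔤 M]
  [AddCommGroup N] [Module K N] [LieRingModule 𝔤 N] [LieModule K 𝔤 N]

omit [LieAlgebra K 𝔤] [LieModule K 𝔤 M] [LieModule K 𝔤 N] in
lemma LieModuleHom.injective_of_ne_zero [LieModule.IsIrreducible K 𝔤 M] (f : M →ₗ⁅K,𝔤⁆ N)
    {m : M} (hm : f m ≠ 0) : Function.Injective f := by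
  rcases eq_bot_or_eq_top f.ker with h | h
  · exact f.ker_eq_bot.mp h
  · exact absurd (f.mem_ker.mp (h.ge (LieSubmodule.mem_top m))) hm

omit [LieAlgebra K 𝔤] [LieModule K 𝔤 M] [LieModule K 𝔤 N] in
lemma LieModuleHom.surjective_of_ne_zero [LieModule.IsIrreducible K 𝔤 N] (f : M →ₗ⁅K,𝔤⁆ N)
    {m : M} (hm : f m ≠ 0) : Function.Surjective f := by
  rcases eq_bot_or_eq_top f.range with h | h
  · exact absurd (h.le (f.mem_range_self m)) (by simpa using hm)
  · exact f.range_eq_top.mp h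

/-- A bijective homomorphism of modules is an isomorphism. -/
noncomputable def LieModuleEquiv.ofBijectiveHom (f : M →ₗ⁅K,𝔤⁆ N) (hf : Function.Bijective f) :
    M ≃ₗ⁅K,𝔤⁆ N :=
  { f with
    invFun := (Equiv.ofBijective f hf).symm
    left_inv := (Equiv.ofBijective f hf).left_inv
    right_inv := (Equiv.ofBijective f hf).right_inv }

end Schur

section SelfDual

variable {K : Type*} [Field K] {𝔤 : Type*} [LieRing 𝔤] [LieAlgebra K 𝔤]
  {L : Type*} [AddCommGroup L] [Module K L] [LieRingModule 𝔤 L] [LieModule K 𝔤 L]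

lemma dualTensorHom_lie {N : Type*} [AddCommGroup N] [Module K N] [LieRingModule 𝔤 N]
    [LieModule K 𝔤 N] (x : 𝔤) (t : Module.Dual K L ⊗[K] N) :
    dualTensorHom K L N ⁅x, t⁆ = ⁅x, dualTensorHom K L N t⁆ := by
  induction t using TensorProduct.induction_on with
  | zero => exact (congrArg (dualTensorHom K L N) (lie_zero x)).trans (by simp)
  | tmul f v =>
    ext w
    simp [TensorProduct.LieModule.lie_tmul_right, sub_eq_add_neg, add_comm]
  | add s t hs ht =>
    exact (congrArg (dualTensorHom K L N) (lie_add x s t)).trans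
      (by rw [map_add, map_add, hs, ht, lie_add])

/-- The tensor square of a self-dual module has a nonzero invariant. -/
lemma exists_invariant_of_equiv_dual [FiniteDimensional K L] [Nontrivial L]
    (e : L ≃ₗ⁅K,𝔤⁆ Module.Dual K L) : ∃ t : L ⊗[K] L, t ≠ 0 ∧ ∀ x : 𝔤, ⁅x, t⁆ = 0 := by
  let E : L ⊗[K] L ≃ₗ[K] Module.Dual K L ⊗[K] L :=
    TensorProduct.congr e.toLinearEquiv (LinearEquiv.refl K L)
  have hE (x : 𝔤) (t : L ⊗[K] L) : E ⁅x, t⁆ = ⁅x, E t⁆ :=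
    (TensorProduct.LieModule.map (e : L →ₗ⁅K,𝔤⁆ Module.Dual K L) LieModuleHom.id).map_lie x t
  have hid : dualTensorHom K L L ((dualTensorHomEquiv K L L).symm LinearMap.id) = LinearMap.id :=
    (dualTensorHomEquiv K L L).apply_symm_apply LinearMap.id
  refine ⟨E.symm ((dualTensorHomEquiv K L L).symm LinearMap.id), ?_, fun x ↦ ?_⟩
  · rw [Ne, LinearEquiv.map_eq_zero_iff, LinearEquiv.map_eq_zero_iff]
    obtain ⟨v, hv⟩ := exists_ne (0 : L)
    exact fun h ↦ hv (LinearMap.congr_fun h v)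
  · apply E.injective
    rw [hE, E.apply_symm_apply, map_zero]
    apply (dualTensorHomEquiv K L L).injective
    change dualTensorHom K L L _ = _
    rw [dualTensorHom_lie, hid, map_zero]
    ext v
    simp

omit [LieAlgebra K 𝔤] [LieModule K 𝔤 L] in
lemma LieModule.IsIrreducible.lieSpan_singleton_eq_top [LieModule.IsIrreducible K 𝔤 L] {v : L}
    (hv : v ≠ 0) : LieSubmodule.lieSpan K 𝔤 {v} = ⊤ :=
  (eq_bot_or_eq_top _).resolve_left fun h ↦
    hv (by simpa [h] using (LieSubmodule.subset_lieSpan (R := K) (L := 𝔤) (Set.mem_singleton v)))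

namespace IsOrthogonalFamily

variable [CharZero K] [IsAlgClosed K] [FiniteDimensional K L] [LieModule.IsIrreducible K 𝔤 L]
  {n : ℕ} {F : Fin n → Fin n → 𝔤} (hF : IsOrthogonalFamily K F)
include hF

omit [IsAlgClosed K] in
lemma highest_dual_weight {lam lam' : Fin n → K} {v : L} (hv : IsOrthogonalHighest F lam v)
    (hneg : orthogonalWeightSpace F L (fun i ↦ -lam i) ≠ ⊥)
    {f : Module.Dual K L} (hf : IsOrthogonalHighest F lam' f) : lam' = lam := by
  obtain ⟨w, hw, hw0⟩ := Submodule.exists_mem_ne_zero_of_ne_bot hneg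
  have hd : ∃ δ d, IsOrthogonalDescendant F f δ d ∧ d w ≠ 0 := by
    by_contra! h
    let P : LieSubmodule K 𝔤 L :=
      { carrier := {y | ∀ g ∈ LieSubmodule.lieSpan K 𝔤 {f}, g y = 0}
        add_mem' := fun ha hb g hg ↦ by rw [map_add, ha g hg, hb g hg, add_zero]
        zero_mem' := fun g _ ↦ map_zero g
        smul_mem' := fun c y hy g hg ↦ by rw [map_smul, hy g hg, smul_zero]
        lie_mem := fun {x y} hy g hg ↦ by
          have := hy ⁅x, g⁆ (LieSubmodule.lie_mem _ hg)
          rwa [Module.Dual.lie_apply, neg_eq_zero] at this }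
    have hwP : w ∈ P := fun g hg ↦ by
      have hle : Submodule.span K {d | ∃ δ, IsOrthogonalDescendant F f δ d} ≤
          (Module.Dual.eval K L w).ker :=
        Submodule.span_le.mpr fun d ⟨δ, hd⟩ ↦ h δ d hd
      exact hle (hF.lieSpan_le_span_descendant hf hg)
    have hP : P = ⊤ := (eq_bot_or_eq_top P).resolve_left fun h ↦ hw0 (by simpa [h] using hwP)
    refine hf.ne_zero (LinearMap.ext fun y ↦ ?_)
    exact (hP.ge (LieSubmodule.mem_top y) : y ∈ P) f (LieSubmodule.subset_lieSpan rfl)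
  obtain ⟨δ, d, hd, hdw⟩ := hd
  have hdδ := mem_weightSpace.mp (hd.mem_weightSpace hF (mem_weightSpace.mpr hf.lie_diag))
  have hlam : lam = fun i ↦ lam' i - δ i := by
    funext i
    have h := LinearMap.congr_fun (hdδ i) w
    rw [Module.Dual.lie_apply, mem_weightSpace.mp hw i] at h
    simp only [neg_smul, map_neg, neg_neg, map_smul, LinearMap.smul_apply] at h
    exact smul_left_injective K hdw h
  have hcas : orthogonalCasimirScalar lam' = orthogonalCasimirScalar lam := by
    refine smul_left_injective K hf.ne_zero ?_
    simp only
    rw [← hF.casimir_highest hf]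
    ext y
    rw [orthogonalCasimir_dual_apply, hF.casimir_of_mem_lieSpan hv (by
      rw [LieModule.IsIrreducible.lieSpan_singleton_eq_top hv.ne_zero]; trivial)]
    simp
  have hδ := (hF.dominant hf).eq_zero_of_casimirScalar_eq hF.even hd.mem_cone
    (hlam ▸ hF.dominant hv) (hlam ▸ hcas)
  rw [hlam, hδ]
  simp

/-- An irreducible module is self-dual if the negative of its highest weight is a weight. -/
theorem nonempty_equiv_dual {lam : Fin n → K} {v : L} (hv : IsOrthogonalHighest F lam v)
    (hneg : orthogonalWeightSpace F L (fun i ↦ -lam i) ≠ ⊥) :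
    Nonempty (L ≃ₗ⁅K,𝔤⁆ Module.Dual K L) := by
  have : Nontrivial L := ⟨v, 0, hv.ne_zero⟩
  obtain ⟨lam', f, hf⟩ := hF.exists_highest (Module.Dual K L)
  obtain rfl := hF.highest_dual_weight hv hneg hf
  have hvf : IsOrthogonalHighest F lam' (v, f) :=
    ⟨fun h ↦ hv.ne_zero (congrArg Prod.fst h),
      fun i ↦ Prod.ext (hv.lie_diag i) (hf.lie_diag i),
      fun i j hij ↦ Prod.ext (hv.lie_eq_zero i j hij) (hf.lie_eq_zero i j hij)⟩
  have := hF.isIrreducible_lieSpan hvf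
  set N := LieSubmodule.lieSpan K 𝔤 {(v, f)}
  let x : N := ⟨(v, f), LieSubmodule.subset_lieSpan rfl⟩
  let p : N →ₗ⁅K,𝔤⁆ L := (LieModuleHom.prodFst K 𝔤 L (Module.Dual K L)).comp N.incl
  let q : N →ₗ⁅K,𝔤⁆ Module.Dual K L := (LieModuleHom.prodSnd K 𝔤 L (Module.Dual K L)).comp N.incl
  have hp : p x ≠ 0 := hv.ne_zero
  have hq : q x ≠ 0 := hf.ne_zero
  let e := LieModuleEquiv.ofBijectiveHom p ⟨p.injective_of_ne_zero hp, p.surjective_of_ne_zero hp⟩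
  have hinj := q.injective_of_ne_zero hq
  have hfin : Module.finrank K N = Module.finrank K (Module.Dual K L) :=
    e.toLinearEquiv.finrank_eq.trans Subspace.dual_finrank_eq.symm
  exact ⟨e.symm.trans (LieModuleEquiv.ofBijectiveHom q
    ⟨hinj, (LinearMap.injective_iff_surjective_of_finrank_eq_finrank hfin (f := q)).mp hinj⟩)⟩

end IsOrthogonalFamily

end SelfDual

section TensorSquare

variable {K : Type*} [Field K] {𝔤 : Type*} [LieRing 𝔤] [LieAlgebra K 𝔤]
  {M : Type*} [AddCommGroup M] [Module K M] [LieRingModule 𝔤 M] [LieModule K 𝔤 M]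

lemma LieModuleHom.tensor_map_injective {N : Type*} [AddCommGroup N] [Module K N]
    [LieRingModule 𝔤 N] [LieModule K 𝔤 N] (f : N →ₗ⁅K,𝔤⁆ M) (hf : Function.Injective f) :
    Function.Injective (TensorProduct.LieModule.map f f) :=
  TensorProduct.map_injective_of_flat_flat (f : N →ₗ[K] M) (f : N →ₗ[K] M) hf hf

lemma TensorProduct.lie_map_of_forall_eq_smul {E : Type*} [AddCommGroup E] [Module K E]
    (f : E →ₗ[K] M) {c : K} {x : 𝔤} (h : ∀ e, ⁅x, f e⁆ = c • f e) (t : E ⊗[K] E) :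
    ⁅x, TensorProduct.map f f t⁆ = (2 * c) • TensorProduct.map f f t := by
  induction t using TensorProduct.induction_on with
  | zero => rw [map_zero, lie_zero, smul_zero]
  | tmul a b =>
    rw [TensorProduct.map_tmul, TensorProduct.LieModule.lie_tmul_right]
    simp [h, two_mul, add_smul, TensorProduct.smul_tmul']
  | add s t hs ht => rw [map_add, lie_add, hs, ht, smul_add]

lemma TensorProduct.lie_map_of_forall_eq {E 𝔨 : Type*} [AddCommGroup E] [Module K E] [LieRing 𝔨]
    [LieAlgebra K 𝔨] [LieRingModule 𝔨 E] [LieModule K 𝔨 E]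
    (f : E →ₗ[K] M) {x : 𝔤} {y : 𝔨} (h : ∀ e, ⁅x, f e⁆ = f ⁅y, e⁆) (t : E ⊗[K] E) :
    ⁅x, TensorProduct.map f f t⁆ = TensorProduct.map f f ⁅y, t⁆ := by
  induction t using TensorProduct.induction_on with
  | zero => rw [map_zero, lie_zero, lie_zero, map_zero]
  | tmul a b => simp [TensorProduct.LieModule.lie_tmul_right, h]
  | add s t hs ht => rw [map_add, lie_add, lie_add, hs, ht, map_add]

/-- A self-dual irreducible submodule gives a nonzero invariant of the tensor square. -/
lemma LieSubmodule.exists_invariant_of_equiv_dual (W : LieSubmodule K 𝔤 M)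
    [FiniteDimensional K W] [LieModule.IsIrreducible K 𝔤 W] (e : W ≃ₗ⁅K,𝔤⁆ Module.Dual K W) :
    ∃ t : M ⊗[K] M, t ≠ 0 ∧ ∀ x : 𝔤, ⁅x, t⁆ = 0 := by
  have := LieModule.nontrivial_of_isIrreducible K 𝔤 W
  obtain ⟨t, ht, ht'⟩ := _root_.exists_invariant_of_equiv_dual e
  refine ⟨TensorProduct.LieModule.map W.incl W.incl t, ?_, fun x ↦ ?_⟩
  · exact (map_ne_zero_iff _ (W.incl.tensor_map_injective W.injective_incl)).mpr ht
  · rw [← LieModuleHom.map_lie, ht', map_zero]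

omit [LieAlgebra K 𝔤] [LieModule K 𝔤 M] in
lemma IsOrthogonalHighest.lieSpan {n : ℕ} {F : Fin n → Fin n → 𝔤} {lam : Fin n → K} {u : M}
    (hu : IsOrthogonalHighest F lam u) :
    IsOrthogonalHighest F lam (⟨u, LieSubmodule.subset_lieSpan rfl⟩ :
      LieSubmodule.lieSpan K 𝔤 {u}) :=
  ⟨fun h ↦ hu.ne_zero (congrArg Subtype.val h), fun i ↦ Subtype.ext (hu.lie_diag i),
    fun i j hij ↦ Subtype.ext (hu.lie_eq_zero i j hij)⟩

namespace IsOrthogonalFamily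

variable [CharZero K] [IsAlgClosed K] [FiniteDimensional K M]

/-- If the rank is even then every tensor square has a nonzero invariant. -/
lemma exists_invariant {n m : ℕ} (hm : n = 4 * m) {F : Fin n → Fin n → 𝔤}
    (hF : IsOrthogonalFamily K F) (M : Type*) [AddCommGroup M] [Module K M] [LieRingModule 𝔤 M]
    [LieModule K 𝔤 M] [FiniteDimensional K M] [Nontrivial M] :
    ∃ t : M ⊗[K] M, t ≠ 0 ∧ ∀ x : 𝔤, ⁅x, t⁆ = 0 := by
  obtain ⟨lam, u, hu⟩ := hF.exists_highest M
  have := hF.isIrreducible_lieSpan hu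
  obtain ⟨e⟩ := hF.nonempty_equiv_dual hu.lieSpan (hF.weightSpace_neg_ne_bot hm
    ((Submodule.ne_bot_iff _).mpr
      ⟨_, mem_weightSpace.mpr hu.lieSpan.lie_diag, hu.lieSpan.ne_zero⟩))
  exact LieSubmodule.exists_invariant_of_equiv_dual _ e

section Middle

variable {N : ℕ} {F : Fin (N + 2) → Fin (N + 2) → 𝔤}

/-- The inclusion of the indices other than the first and the last one. -/
def middle (i : Fin N) : Fin (N + 2) := i.castSucc.succ

lemma middle_injective : Function.Injective (middle (N := N)) := fun i j h ↦ by
  simpa [middle] using h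

lemma middle_rev (i : Fin N) : middle i.rev = (middle i).rev := by
  simp [middle, Fin.rev_succ, Fin.rev_castSucc]

/-- The subalgebra spanned by the elements with indices other than the first and the last one. -/
def middleSubalgebra (hF : IsOrthogonalFamily K F) : LieSubalgebra K 𝔤 where
  __ := Submodule.span K (Set.range fun p : Fin N × Fin N ↦ F (middle p.1) (middle p.2))
  lie_mem' := fun {x y} hx hy ↦ by
    simp only [AddSubsemigroup.mem_carrier, AddSubmonoid.mem_toSubsemigroup,
      Submodule.mem_toAddSubmonoid] at hx hy ⊢
    set S := Submodule.span K (Set.range fun p : Fin N × Fin N ↦ F (middle p.1) (middle p.2))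
    have hS (i j : Fin N) : F (middle i) (middle j) ∈ S := Submodule.subset_span ⟨(i, j), rfl⟩
    induction hx, hy using Submodule.span_induction₂ with
    | mem_mem x y hx hy =>
      obtain ⟨⟨k, l⟩, rfl⟩ := hx
      obtain ⟨⟨i, j⟩, rfl⟩ := hy
      simp only [hF.lie_eq, ← middle_rev]
      refine add_mem (sub_mem (sub_mem ?_ ?_) ?_) ?_ <;> split_ifs <;>
        first | exact hS _ _ | exact zero_mem _
    | zero_left => simp
    | zero_right => simp
    | add_left x y z _ _ _ hx hy =>
      rw [add_lie]
      exact add_mem hx hy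
    | add_right x y z _ _ _ hx hy =>
      rw [lie_add]
      exact add_mem hx hy
    | smul_left c x y _ _ h =>
      rw [smul_lie]
      exact S.smul_mem c h
    | smul_right c x y _ _ h =>
      rw [lie_smul]
      exact S.smul_mem c h

variable (hF : IsOrthogonalFamily K F)

/-- The family spanning `middleSubalgebra`. -/
def middleFamily (i j : Fin N) : hF.middleSubalgebra :=
  ⟨F (middle i) (middle j), Submodule.subset_span ⟨(i, j), rfl⟩⟩

omit [CharZero K] [IsAlgClosed K] in
lemma isOrthogonalFamily_middleFamily : IsOrthogonalFamily K hF.middleFamily where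
  even := by
    have := hF.even
    rwa [Nat.even_add, iff_true_right even_two] at this
  span_eq_top := by
    apply Submodule.map_injective_of_injective
      (f := (hF.middleSubalgebra.toSubmodule.subtype)) Subtype.val_injective
    rw [Submodule.map_span, ← Set.range_comp, Submodule.map_top, Submodule.range_subtype]
    rfl
  neg_rev i j := Subtype.ext (by
    change F _ _ = -F _ _
    rw [middle_rev, middle_rev, hF.neg_rev])
  lie_eq k l i j := Subtype.ext (by
    have h (p : Prop) [Decidable p] (x : hF.middleSubalgebra) :
        ((if p then x else 0 : hF.middleSubalgebra) : 𝔤) = if p then (x : 𝔤) else 0 := by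
      split_ifs <;> rfl
    simp only [LieSubalgebra.coe_bracket, AddMemClass.coe_add, AddSubgroupClass.coe_sub, h]
    simp only [middleFamily, hF.lie_eq, ← middle_rev, middle_injective.eq_iff])

/-- The weight supported on the first and the last coordinate. -/
def outerWeight (N : ℕ) (κ : K) : Fin (N + 2) → K := Pi.single 0 κ - Pi.single (Fin.last _) κ

lemma eq_zero_or_last_or_middle (i : Fin (N + 2)) :
    i = 0 ∨ i = Fin.last _ ∨ ∃ j : Fin N, i = middle j := by
  induction i using Fin.cases with
  | zero => exact .inl rfl
  | succ i =>
    induction i using Fin.lastCases with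
    | last => exact .inr (.inl rfl)
    | cast i => exact .inr (.inr ⟨i, rfl⟩)

include hF in
lemma exists_outer_highest_of_odd {m : ℕ} (hm : N = 4 * m) (M : Type*) [AddCommGroup M]
    [Module K M] [LieRingModule 𝔤 M] [LieModule K 𝔤 M] [FiniteDimensional K M] [Nontrivial M] :
    ∃ (κ : K) (t : M ⊗[K] M), IsOrthogonalHighest F (outerWeight N κ) t := by
  let T : Module.End K M := LieModule.toEnd K 𝔤 M (F 0 0)
  obtain ⟨c₀, hc₀⟩ := Module.End.exists_eigenvalue T
  obtain ⟨a, ha, hmax⟩ := T.exists_max_shift (fun k ↦ T.eigenspace (c₀ + k)) (p := c₀)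
    one_ne_zero (fun k v hv ↦ by simpa [Module.End.mem_eigenspace_iff] using hv)
    (by rw [Int.cast_zero, add_zero]; exact hc₀)
  set c : K := c₀ + (a : ℤ) with hc
  have hzero : ∀ j : Fin (N + 2), j ≠ 0 → ∀ e ∈ T.eigenspace c, ⁅F 0 j, e⁆ = 0 := by
    intro j hj e he
    rcases eq_or_ne j (Fin.rev 0) with rfl | hj'
    · rw [hF.apply_rev, zero_lie]
    · have h0 := hmax (a + 1) (by omega)
      rw [← Submodule.mem_bot K, ← h0, Module.End.mem_eigenspace_iff]
      rw [Module.End.mem_eigenspace_iff] at he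
      change ⁅F 0 0, e⁆ = _ at he
      change ⁅F 0 0, ⁅F 0 j, e⁆⁆ = _
      rw [leibniz_lie, hF.lie_diag, he, orthogonalRoot_apply_left hF.even hj.symm
        (fun h ↦ hj' (by rw [h, Fin.rev_rev])), lie_smul, smul_lie, ← add_smul, hc]
      congr 1
      push_cast
      ring
  have hcomm (x : hF.middleSubalgebra) : ⁅F 0 0, (x : 𝔤)⁆ = 0 := by
    obtain ⟨x, hx⟩ := x
    have hle : Submodule.span K
        (Set.range fun p : Fin N × Fin N ↦ F (middle p.1) (middle p.2)) ≤
        (LieAlgebra.ad K 𝔤 (F 0 0)).ker := by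
      rw [Submodule.span_le]
      rintro _ ⟨⟨i, j⟩, rfl⟩
      have h1 (i : Fin N) : (0 : Fin (N + 2)) ≠ middle i := (Fin.succ_ne_zero _).symm
      simp only [SetLike.mem_coe, LinearMap.mem_ker, LieAlgebra.ad_apply, hF.lie_diag]
      simp [orthogonalRoot, ← middle_rev, h1]
    exact hle hx
  let E : LieSubmodule K hF.middleSubalgebra M :=
    { T.eigenspace c with
      lie_mem := fun {x e} he ↦ by
        change ⁅(x : 𝔤), e⁆ ∈ T.eigenspace c
        change e ∈ T.eigenspace c at he
        rw [Module.End.mem_eigenspace_iff] at he ⊢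
        change ⁅F 0 0, e⁆ = _ at he
        change ⁅F 0 0, ⁅(x : 𝔤), e⁆⁆ = _
        rw [leibniz_lie, hcomm, zero_lie, zero_add, he, lie_smul] }
  have : Nontrivial E := Submodule.nontrivial_iff_ne_bot.mpr ha
  obtain ⟨t, ht0, ht⟩ := exists_invariant hm hF.isOrthogonalFamily_middleFamily E
  let f : E →ₗ[K] M := E.toSubmodule.subtype
  have hmid (i j : Fin N) : ⁅F (middle i) (middle j), TensorProduct.map f f t⁆ = 0 := by
    rw [TensorProduct.lie_map_of_forall_eq f (x := F (middle i) (middle j))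
      (y := hF.middleFamily i j) (fun _ ↦ rfl), ht,
      map_zero]
  have h0 (j : Fin (N + 2)) (hj : j ≠ 0) : ⁅F 0 j, TensorProduct.map f f t⁆ = 0 := by
    rw [TensorProduct.lie_map_of_forall_eq_smul f (c := 0)
      (fun e ↦ by rw [zero_smul]; exact hzero j hj e e.2), mul_zero, zero_smul]
  have hdiag : ⁅F 0 0, TensorProduct.map f f t⁆ = (2 * c) • TensorProduct.map f f t :=
    TensorProduct.lie_map_of_forall_eq_smul f (fun e ↦ Module.End.mem_eigenspace_iff.mp e.2) t
  refine ⟨2 * c, TensorProduct.map f f t, ?_, fun i ↦ ?_, fun i j hij ↦ ?_⟩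
  · exact (map_ne_zero_iff _ (TensorProduct.map_injective_of_flat_flat f f
      Subtype.val_injective Subtype.val_injective)).mpr ht0
  · rcases eq_zero_or_last_or_middle i with rfl | rfl | ⟨i, rfl⟩
    · rw [hdiag]
      simp [outerWeight]
    · rw [hF.neg_rev, Fin.rev_last, neg_lie, hdiag]
      simp [outerWeight]
    · rw [hmid]
      have h1 : middle i ≠ 0 := Fin.succ_ne_zero _
      have h2 : middle i ≠ Fin.last (N + 1) := fun h ↦
        i.castSucc_ne_last (Fin.succ_injective _ h)
      simp [outerWeight, h1, h2]
  · rcases eq_zero_or_last_or_middle i with rfl | rfl | ⟨i, rfl⟩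
    · exact h0 j hij.ne'
    · exact absurd hij j.le_last.not_gt
    · rcases eq_zero_or_last_or_middle j with rfl | rfl | ⟨j, rfl⟩
      · exact absurd hij (Fin.zero_le _).not_gt
      · rw [hF.neg_rev, Fin.rev_last, neg_lie, h0 _ ?_, neg_zero]
        rw [← middle_rev]
        exact Fin.succ_ne_zero _
      · exact hmid i j

include hF in
lemma exists_outer_highest (M : Type*) [AddCommGroup M]
    [Module K M] [LieRingModule 𝔤 M] [LieModule K 𝔤 M] [FiniteDimensional K M] [Nontrivial M] :
    ∃ (κ : K) (t : M ⊗[K] M), IsOrthogonalHighest F (outerWeight N κ) t := by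
  obtain ⟨p, hp⟩ := hF.even
  rcases Nat.even_or_odd' p with ⟨m, rfl | rfl⟩
  · obtain ⟨t, ht0, ht⟩ := exists_invariant (m := m) (by omega) hF M
    exact ⟨0, t, ht0, fun i ↦ by simp [ht, outerWeight], fun i j _ ↦ ht _⟩
  · exact hF.exists_outer_highest_of_odd (m := m) (by omega) M

include hF in
/-- The tensor square of any nontrivial module has a self-dual irreducible submodule. -/
theorem exists_selfDual_submodule (hN : 2 ≤ N) (M : Type*) [AddCommGroup M]
    [Module K M] [LieRingModule 𝔤 M] [LieModule K 𝔤 M] [FiniteDimensional K M] [Nontrivial M] :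
    ∃ W : LieSubmodule K 𝔤 (M ⊗[K] M), LieModule.IsIrreducible K 𝔤 W ∧
      Nonempty (W ≃ₗ⁅K,𝔤⁆ Module.Dual K W) := by
  obtain ⟨κ, t, ht⟩ := hF.exists_outer_highest M
  have := hF.isIrreducible_lieSpan ht
  refine ⟨LieSubmodule.lieSpan K 𝔤 {t}, this, ?_⟩
  refine hF.nonempty_equiv_dual ht.lieSpan ?_
  have h1 : (0 : Fin (N + 2)) ≠ 1 := by simp
  have h2 : (0 : Fin (N + 2)) ≠ Fin.rev 1 := by
    rw [Ne, Fin.ext_iff, Fin.val_rev]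
    simp
    omega
  convert hF.weightSpace_flip_ne_bot ((Submodule.ne_bot_iff _).mpr
    ⟨_, mem_weightSpace.mpr ht.lieSpan.lie_diag, ht.lieSpan.ne_zero⟩) h1 h2 using 3 with i
  rw [Fin.rev_zero]
  by_cases hi : i = 0 ∨ i = Fin.last _
  · rw [if_pos (by tauto)]
  · push Not at hi
    simp [outerWeight, hi]

end Middle

end IsOrthogonalFamily

end TensorSquare

section TensorPower

variable (K : Type*) [Field K] (V : Type*) [AddCommGroup V] [Module K V]

/-- The fourth tensor power as the tensor square of the tensor square. -/
noncomputable def tensorSquareSquareEquiv : (V ⊗[K] V) ⊗[K] (V ⊗[K] V) ≃ₗ[K] ⨂[K]^4 V :=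
  let e₁ : V ≃ₗ[K] ⨂[K]^1 V :=
    (PiTensorProduct.subsingletonEquiv (R := K) (s := fun _ ↦ V) (0 : Fin 1)).symm
  let e₂ : V ⊗[K] V ≃ₗ[K] ⨂[K]^2 V :=
    (TensorProduct.congr e₁ e₁).trans (TensorPower.mulEquiv (n := 1) (m := 1))
  (TensorProduct.congr e₂ e₂).trans (TensorPower.mulEquiv (n := 2) (m := 2))

lemma tensorSquareSquareEquiv_tmul (a b c d : V) :
    tensorSquareSquareEquiv K V ((a ⊗ₜ b) ⊗ₜ (c ⊗ₜ d)) = PiTensorProduct.tprod K ![a, b, c, d] := by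
  have h1 (x y : V) : TensorPower.mulEquiv (n := 1) (m := 1)
      (PiTensorProduct.tprod K (fun _ ↦ x) ⊗ₜ[K] PiTensorProduct.tprod K (fun _ ↦ y)) =
      PiTensorProduct.tprod K ![x, y] := by
    rw [← TensorPower.gMul_def, TensorPower.tprod_mul_tprod]
    congr 1
    ext i
    fin_cases i <;> rfl
  simp only [tensorSquareSquareEquiv, LinearEquiv.trans_apply, TensorProduct.congr_tmul,
    PiTensorProduct.subsingletonEquiv_symm_apply', h1]
  rw [← TensorPower.gMul_def, TensorPower.tprod_mul_tprod]
  congr 1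
  ext i
  fin_cases i <;> rfl

variable {K V} {𝔤 : Type*} [LieRing 𝔤] [LieAlgebra K 𝔤] [LieRingModule 𝔤 V] [LieModule K 𝔤 V]

lemma tensorPowerLieAction_tprod_four (x : 𝔤) (a b c d : V) :
    tensorPowerLieAction K 𝔤 V 4 x (PiTensorProduct.tprod K ![a, b, c, d]) =
      PiTensorProduct.tprod K ![⁅x, a⁆, b, c, d] + PiTensorProduct.tprod K ![a, ⁅x, b⁆, c, d] +
      PiTensorProduct.tprod K ![a, b, ⁅x, c⁆, d] + PiTensorProduct.tprod K ![a, b, c, ⁅x, d⁆] := by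
  simp only [tensorPowerLieAction, Fin.sum_univ_four, LinearMap.add_apply,
    PiTensorProduct.map_tprod]
  congr 1
  · congr 1
    · congr 1
      all_goals
        congr 1
        ext i
        fin_cases i <;> simp [Function.update]
    · congr 1
      ext i
      fin_cases i <;> simp [Function.update]
  · congr 1
    ext i
    fin_cases i <;> simp [Function.update]

lemma tensorPowerLieAction_tensorSquareSquareEquiv (x : 𝔤) (t : (V ⊗[K] V) ⊗[K] (V ⊗[K] V)) :
    tensorPowerLieAction K 𝔤 V 4 x (tensorSquareSquareEquiv K V t) =
      tensorSquareSquareEquiv K V ⁅x, t⁆ := by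
  suffices (tensorPowerLieAction K 𝔤 V 4 x) ∘ₗ (tensorSquareSquareEquiv K V).toLinearMap =
      (tensorSquareSquareEquiv K V).toLinearMap ∘ₗ LieModule.toEnd K 𝔤 _ x from
    LinearMap.congr_fun this t
  refine TensorProduct.ext_fourfold' fun a b c d ↦ ?_
  simp only [LinearMap.comp_apply, LinearEquiv.coe_coe, LieModule.toEnd_apply_apply,
    TensorProduct.LieModule.lie_tmul_right, TensorProduct.add_tmul, TensorProduct.tmul_add,
    map_add, tensorSquareSquareEquiv_tmul, tensorPowerLieAction_tprod_four]
  abel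

lemma tensorPowerInvariants_four_ne_bot
    (h : ∃ t : (V ⊗[K] V) ⊗[K] (V ⊗[K] V), t ≠ 0 ∧ ∀ x : 𝔤, ⁅x, t⁆ = 0) :
    tensorPowerInvariants K 𝔤 V 4 ≠ ⊥ := by
  obtain ⟨t, ht0, ht⟩ := h
  refine (Submodule.ne_bot_iff _).mpr ⟨tensorSquareSquareEquiv K V t, ?_, by simpa using ht0⟩
  refine (Submodule.mem_iInf _).mpr fun x ↦ LinearMap.mem_ker.mpr ?_
  rw [tensorPowerLieAction_tensorSquareSquareEquiv, ht, map_zero]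

end TensorPower

section Orthogonal

lemma IsOrthogonalFamily.map {K : Type*} [Field K] {𝔤 𝔥 : Type*} [LieRing 𝔤] [LieAlgebra K 𝔤]
    [LieRing 𝔥] [LieAlgebra K 𝔥] {n : ℕ} {F : Fin n → Fin n → 𝔤} (hF : IsOrthogonalFamily K F)
    (e : 𝔤 ≃ₗ⁅K⁆ 𝔥) : IsOrthogonalFamily K fun i j ↦ e (F i j) where
  even := hF.even
  span_eq_top := by
    have h := congrArg (Submodule.map (e : 𝔤 →ₗ[K] 𝔥)) hF.span_eq_top
    rw [Submodule.map_span, ← Set.range_comp, Submodule.map_top, LinearMap.range_eq_top.mpr] at h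
    · exact h
    · exact e.surjective
  neg_rev i j := by rw [hF.neg_rev, map_neg]
  lie_eq k l i j := by
    rw [← LieEquiv.map_lie, hF.lie_eq]
    simp only [map_add, map_sub, apply_ite e, map_zero]

variable (K : Type*) [Field K] (n : ℕ)

open Matrix

/-- The matrix of the antidiagonal symmetric form. -/
def antidiagonalMatrix : Matrix (Fin n) (Fin n) K :=
  Matrix.of fun i j ↦ if i = j.rev then 1 else 0

/-- The elements `E i j - E (n - 1 - j) (n - 1 - i)`, which are skew-adjoint for the antidiagonal
form. -/
def antidiagonalUnit {n : ℕ} (i j : Fin n) : Matrix (Fin n) (Fin n) K :=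
  Matrix.single i j 1 - Matrix.single j.rev i.rev 1

lemma antidiagonalMatrix_mul_self : antidiagonalMatrix K n * antidiagonalMatrix K n = 1 := by
  ext i j
  simp [antidiagonalMatrix, Matrix.mul_apply, Matrix.one_apply]

lemma antidiagonalMatrix_transpose : (antidiagonalMatrix K n)ᵀ = antidiagonalMatrix K n := by
  ext i j
  have h : j = i.rev ↔ i = j.rev := by rw [eq_comm, Fin.rev_eq_iff]
  simp [antidiagonalMatrix, h]

lemma antidiagonalMatrix_mul_mul_apply (A : Matrix (Fin n) (Fin n) K) (i j : Fin n) :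
    (antidiagonalMatrix K n * A * antidiagonalMatrix K n) i j = A i.rev j.rev := by
  have h (a b : Fin n) : a = b.rev ↔ b = a.rev := by rw [eq_comm, Fin.rev_eq_iff]
  simp [antidiagonalMatrix, Matrix.mul_apply, h i]

lemma antidiagonalUnit_transpose {n : ℕ} (i j : Fin n) :
    antidiagonalMatrix K n * (antidiagonalUnit K i j)ᵀ * antidiagonalMatrix K n =
      -antidiagonalUnit K i j := by
  ext a b
  rw [antidiagonalMatrix_mul_mul_apply]
  simp only [antidiagonalUnit, Matrix.transpose_apply, Matrix.sub_apply, Matrix.neg_apply,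
    Matrix.single_apply, neg_sub, Fin.rev_inj]
  congr 1
  · exact if_congr (by rw [and_comm, Fin.rev_eq_iff, Fin.rev_eq_iff]) rfl rfl
  · exact if_congr and_comm rfl rfl

lemma antidiagonalUnit_commutator {n : ℕ} (k l i j : Fin n) :
    antidiagonalUnit K k l * antidiagonalUnit K i j -
        antidiagonalUnit K i j * antidiagonalUnit K k l =
      (if l = i then antidiagonalUnit K k j else 0)
        - (if j = k then antidiagonalUnit K i l else 0)
        - (if i = k.rev then antidiagonalUnit K l.rev j else 0)
        + (if j = l.rev then antidiagonalUnit K i k.rev else 0) := by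
  have h (a b c d : Fin n) : (Matrix.single a b 1 * Matrix.single c d 1 : Matrix _ _ K) =
      if b = c then Matrix.single a d 1 else 0 := by
    split_ifs with hbc
    · subst hbc
      simp
    · simp [hbc]
  have e1 : l = j.rev ↔ j = l.rev := by rw [eq_comm, Fin.rev_eq_iff]
  have e2 : k.rev = i ↔ i = k.rev := eq_comm
  have e3 : k.rev = j.rev ↔ j = k := by rw [Fin.rev_inj, eq_comm]
  have e4 : i.rev = k ↔ i = k.rev := Fin.rev_eq_iff
  have e5 : i.rev = l.rev ↔ l = i := by rw [Fin.rev_inj, eq_comm]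
  simp only [antidiagonalUnit, sub_mul, mul_sub, h, e1, e2, e3, e4, e5, Fin.rev_rev]
  split_ifs <;> abel

variable {K n}

lemma sum_smul_antidiagonalUnit {a : Matrix (Fin n) (Fin n) K}
    (ha : antidiagonalMatrix K n * aᵀ * antidiagonalMatrix K n = -a) :
    ∑ i, ∑ j, a i j • antidiagonalUnit K i j = (2 : K) • a := by
  ext p q
  have h := congrFun₂ ha p q
  rw [antidiagonalMatrix_mul_mul_apply] at h
  have h1 (i j : Fin n) : (i.rev = q ∧ j.rev = p) ↔ (i = q.rev ∧ j = p.rev) := by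
    rw [Fin.rev_eq_iff, Fin.rev_eq_iff]
  simp only [Matrix.transpose_apply, Matrix.neg_apply] at h
  simp only [antidiagonalUnit, Matrix.sum_apply, Matrix.smul_apply, Matrix.sub_apply,
    Matrix.single_apply, smul_eq_mul, mul_sub, Finset.sum_sub_distrib, and_comm (a := _ = p), h1]
  simp [ite_and, h, two_mul]

/-- A change of basis from the standard symmetric form to the antidiagonal one. -/
lemma exists_transpose_mul_eq_antidiagonalMatrix [IsAlgClosed K] [CharZero K] (n : ℕ) :
    ∃ P : Matrix (Fin n) (Fin n) K, Pᵀ * P = antidiagonalMatrix K n := by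
  obtain ⟨I, hI⟩ := IsAlgClosed.exists_pow_nat_eq (-1 : K) two_pos
  have hI0 : I ≠ 0 := by
    rintro rfl
    simp at hI
  obtain ⟨c, hc⟩ := IsAlgClosed.exists_pow_nat_eq (2 * I)⁻¹ two_pos
  refine ⟨c • (1 + I • antidiagonalMatrix K n), ?_⟩
  have h : (1 + I • antidiagonalMatrix K n) * (1 + I • antidiagonalMatrix K n) =
      (2 * I) • antidiagonalMatrix K n := by
    rw [mul_add, add_mul, add_mul, smul_mul_smul_comm, antidiagonalMatrix_mul_self, ← sq I, hI]
    simp only [mul_one, one_mul, mul_smul, two_smul, neg_smul, one_smul]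
    abel
  rw [transpose_smul, transpose_add, transpose_one, transpose_smul, antidiagonalMatrix_transpose,
    smul_mul_smul_comm, h, ← sq, hc, smul_smul, inv_mul_cancel₀ (by simp [hI0]), one_smul]

lemma exists_isOrthogonalFamily_so [IsAlgClosed K] [CharZero K] (hn : Even n) :
    ∃ F : Fin n → Fin n → LieAlgebra.Orthogonal.so (Fin n) K, IsOrthogonalFamily K F := by
  obtain ⟨P, hP⟩ := exists_transpose_mul_eq_antidiagonalMatrix (K := K) n
  set J := antidiagonalMatrix K n with hJ
  have hJJ : J * J = 1 := antidiagonalMatrix_mul_self K n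
  have hJt : Jᵀ = J := antidiagonalMatrix_transpose K n
  obtain ⟨Q, hQ⟩ : ∃ Q, Q = J * Pᵀ := ⟨_, rfl⟩
  have hQP : Q * P = 1 := by rw [hQ, mul_assoc, hP, hJJ]
  have hPQ : P * Q = 1 := mul_eq_one_comm.mp hQP
  have hQt : Qᵀ = P * J := by rw [hQ, transpose_mul, transpose_transpose, hJt]
  have hPt : Pᵀ = J * Q := by rw [hQ, ← mul_assoc, hJJ, one_mul]
  have hmul (A B : Matrix (Fin n) (Fin n) K) : P * A * Q * (P * B * Q) = P * (A * B) * Q := by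
    rw [mul_assoc _ Q, ← mul_assoc Q, ← mul_assoc Q, hQP, one_mul]
    simp only [mul_assoc]
  have hmem (i j : Fin n) :
      P * antidiagonalUnit K i j * Q ∈ LieAlgebra.Orthogonal.so (Fin n) K := by
    rw [LieAlgebra.Orthogonal.mem_so, transpose_mul, transpose_mul, hQt, hPt]
    have h := antidiagonalUnit_transpose K i j
    rw [← neg_mul, ← mul_neg, ← h]
    simp only [mul_assoc, hJ]
  let F (i j : Fin n) : LieAlgebra.Orthogonal.so (Fin n) K :=
    ⟨P * antidiagonalUnit K i j * Q, hmem i j⟩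
  refine ⟨F, hn, ?_, fun i j ↦ ?_, fun k l i j ↦ ?_⟩
  · refine eq_top_iff.mpr fun A _ ↦ ?_
    have hA := (LieAlgebra.Orthogonal.mem_so _ _ A.1).mp A.2
    have ha : J * (Q * A.1 * P)ᵀ * J = -(Q * A.1 * P) := by
      rw [transpose_mul, transpose_mul, hQt, hPt, hA]
      simp only [mul_assoc, hJJ, mul_one, mul_neg, neg_mul]
      rw [← mul_assoc J J, hJJ, one_mul]
    have h := sum_smul_antidiagonalUnit ha
    have : A = (2 : K)⁻¹ • ∑ i, ∑ j, (Q * A.1 * P) i j • F i j := by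
      apply Subtype.ext
      have h2 : P * (∑ i, ∑ j, (Q * A.1 * P) i j • antidiagonalUnit K i j) * Q =
          (2 : K) • A.1 := by
        rw [h, mul_smul_comm, smul_mul_assoc, mul_assoc, mul_assoc, hPQ, mul_one, ← mul_assoc, hPQ,
          one_mul]
      simp only [Finset.mul_sum, Finset.sum_mul, mul_smul_comm, smul_mul_assoc] at h2
      push_cast
      rw [eq_inv_smul_iff₀ two_ne_zero]
      exact h2.symm
    rw [this]
    exact Submodule.smul_mem _ _ (Submodule.sum_mem _ fun i _ ↦ Submodule.sum_mem _ fun j _ ↦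
      Submodule.smul_mem _ _ (Submodule.subset_span ⟨(i, j), rfl⟩))
  · apply Subtype.ext
    simp [F, antidiagonalUnit, mul_sub, sub_mul]
  · apply Subtype.ext
    have h := congrArg (fun A ↦ P * A * Q) (antidiagonalUnit_commutator K k l i j)
    simp only [mul_sub, sub_mul, mul_add, add_mul, ← hmul] at h
    simp only [mul_ite, ite_mul, mul_zero, zero_mul] at h
    push_cast
    rw [Ring.lie_def]
    simpa [F, apply_ite Subtype.val] using h

end Orthogonal

/-- Let `𝔤` be a simple Lie algebra of type `D_l` with `l ≥ 4` over an
algebraically closed field `K` of characteristic `0` (concretely, `𝔤 ≅ so(2l, K)`). Then for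
every finite-dimensional irreducible `𝔤`-module `V`, the tensor square `V ⊗ V` contains a
self-dual irreducible submodule, and consequently `(V^{⊗4})^𝔤 ≠ 0`. In particular, if
`r := dim V > 4`, then `V` does not satisfy `(V^{⊗n})^𝔤 = 0` for all `1 ≤ n < r`. -/
theorem typeD_tensor_square_has_selfDual_submodule
    (K : Type*) [Field K] [IsAlgClosed K] [CharZero K]
    (𝔤 : Type*) [LieRing 𝔤] [LieAlgebra K 𝔤] [LieAlgebra.IsSimple K 𝔤]
    (l : ℕ) (hl : 4 ≤ l)
    (hD : Nonempty (𝔤 ≃ₗ⁅K⁆ LieAlgebra.Orthogonal.so (Fin (2 * l)) K))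
    (V : Type*) [AddCommGroup V] [Module K V] [LieRingModule 𝔤 V] [LieModule K 𝔤 V]
    [FiniteDimensional K V] [LieModule.IsIrreducible K 𝔤 V] :
    (∃ W : LieSubmodule K 𝔤 (V ⊗[K] V), LieModule.IsIrreducible K 𝔤 W ∧
        Nonempty (W ≃ₗ⁅K,𝔤⁆ Module.Dual K W)) ∧
      tensorPowerInvariants K 𝔤 V 4 ≠ ⊥ ∧
      (4 < Module.finrank K V →
        ¬ ∀ n : ℕ, 1 ≤ n → n < Module.finrank K V → tensorPowerInvariants K 𝔤 V n = ⊥) := by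
  obtain ⟨e⟩ := hD
  obtain ⟨p, rfl⟩ : ∃ p, l = p + 1 := ⟨l - 1, by omega⟩
  obtain ⟨F, hF⟩ := exists_isOrthogonalFamily_so (K := K) (n := 2 * (p + 1)) (even_two_mul _)
  have := LieModule.nontrivial_of_isIrreducible K 𝔤 V
  obtain ⟨W, hW, ⟨f⟩⟩ := IsOrthogonalFamily.exists_selfDual_submodule (N := 2 * p)
    (hF.map e.symm) (by omega) V
  have h4 : tensorPowerInvariants K 𝔤 V 4 ≠ ⊥ :=
    tensorPowerInvariants_four_ne_bot (W.exists_invariant_of_equiv_dual f)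
  exact ⟨⟨W, hW, ⟨f⟩⟩, h4, fun hr h ↦ h4 (h 4 (by norm_num) hr)⟩
end

section
/- Let 𝔤 be a finite-dimensional semisimple Lie algebra over an algebraically closed field K of characteristic 0, with Cartan subalgebra 𝔥 and base Δ of simple roots, and let V(λ) be the irreducible 𝔤-module of highest weight λ. Then for every simple root α ∈ Δ and every integer t with 0 ≤ t ≤ ⟨λ, α⟩, the weight 2λ − tα occurs in the tensor square V(λ) ⊗ V(λ) with multiplicity exactly t + 1, i.e. dim (V(λ) ⊗ V(λ))_{2λ − tα} = t + 1. -/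
open scoped TensorProduct

section WeightTheory

variable (K : Type*) [Field K]
variable (𝔤 : Type*) [LieRing 𝔤] [LieAlgebra K 𝔤]
variable (H : LieSubalgebra K 𝔤)

/-- The weight space `M_μ = {v | h ⬝ v = μ(h) v for all h ∈ H}` of a `𝔤`-module `M`,
for a linear functional `μ` on the Cartan subalgebra `H`. -/
def hWeightSpace (M : Type*) [AddCommGroup M] [Module K M]
    [LieRingModule 𝔤 M] [LieModule K 𝔤 M] (μ : Module.Dual K H) : Submodule K M where
  carrier := {v | ∀ h : H, ⁅(h : 𝔤), v⁆ = μ h • v}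
  add_mem' := by
    intro a b ha hb h
    rw [lie_add, ha h, hb h, smul_add]
  zero_mem' := by
    intro h
    simp
  smul_mem' := by
    intro c a ha h
    rw [lie_smul, ha h, smul_comm]

/-- The root space `𝔤_α` for `α : H →ₗ K`, i.e. the weight space of the adjoint module. -/
def hRootSpace (α : Module.Dual K H) : Submodule K 𝔤 :=
  hWeightSpace K 𝔤 H 𝔤 α

/-- `α` is a root of `𝔤` with respect to the Cartan subalgebra `H` if it is a nonzero
functional with nonzero root space. -/
def IsLieRoot (α : Module.Dual K H) : Prop :=
  α ≠ 0 ∧ hRootSpace K 𝔤 H α ≠ ⊥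

/-- `Δ` is a base of simple roots: a linearly independent set of roots such that every root
is an integral linear combination of elements of `Δ` with all coefficients of the same sign. -/
def IsRootBase (Δ : Finset (Module.Dual K H)) : Prop :=
  (∀ α ∈ Δ, IsLieRoot K 𝔤 H α) ∧
    LinearIndependent K (fun a : (Δ : Set (Module.Dual K H)) => (a : Module.Dual K H)) ∧
    ∀ β : Module.Dual K H, IsLieRoot K 𝔤 H β →
      ∃ c : Module.Dual K H → ℤ, β = ∑ α ∈ Δ, c α • α ∧
        ((∀ α ∈ Δ, 0 ≤ c α) ∨ (∀ α ∈ Δ, c α ≤ 0))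

/-- `hα ∈ H` is the coroot of the root `α`: it satisfies `α(hα) = 2` and lies in
`[𝔤_α, 𝔤_{-α}]`, so that `⟨λ, α⟩ = 2(λ,α)/(α,α) = λ(hα)` for every weight `λ`. -/
def IsCoroot (α : Module.Dual K H) (hα : H) : Prop :=
  α hα = 2 ∧ ∃ e ∈ hRootSpace K 𝔤 H α, ∃ f ∈ hRootSpace K 𝔤 H (-α), ⁅e, f⁆ = (hα : 𝔤)

/-- `v` is a highest weight vector of weight `λ` (with respect to the base `Δ`):
it is a nonzero vector of weight `λ` killed by all the simple root spaces. -/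
def IsHighestWeightVector (Δ : Finset (Module.Dual K H))
    (M : Type*) [AddCommGroup M] [Module K M] [LieRingModule 𝔤 M] [LieModule K 𝔤 M]
    (lam : Module.Dual K H) (v : M) : Prop :=
  v ≠ 0 ∧ v ∈ hWeightSpace K 𝔤 H M lam ∧
    ∀ α ∈ Δ, ∀ e ∈ hRootSpace K 𝔤 H α, ⁅e, v⁆ = 0

/-- `M` has highest weight `λ` (with respect to the base `Δ`). -/
def IsHighestWeight (Δ : Finset (Module.Dual K H))
    (M : Type*) [AddCommGroup M] [Module K M] [LieRingModule 𝔤 M] [LieModule K 𝔤 M]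
    (lam : Module.Dual K H) : Prop :=
  ∃ v : M, IsHighestWeightVector K 𝔤 H Δ M lam v

end WeightTheory

section Auxiliary

open LieModule LieAlgebra LieAlgebra.IsKilling Module

/-- If `c` and `c + 2` are eigenvalues of `h` on a finite-dimensional module on which `e` acts
nilpotently, then `e` does not annihilate the `c`-eigenspace of `h`. -/
lemma IsSl2Triple.exists_lie_e_ne_zero {K L M : Type*} [Field K] [CharZero K]
    [LieRing L] [LieAlgebra K L] [AddCommGroup M] [Module K M] [LieRingModule L M]
    [LieModule K L M] [FiniteDimensional K M] {h e f : L} (t : IsSl2Triple h e f)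
    (he : IsNilpotent (toEnd K L M e)) {c : K} {y z : M} (hy : y ≠ 0) (hz : z ≠ 0)
    (hhy : ⁅h, y⁆ = c • y) (hhz : ⁅h, z⁆ = (c + 2) • z) :
    ⁅e, y⁆ ≠ 0 ∨ ∃ k : ℕ, ⁅e, (toEnd K L M f ^ (k + 1)) ((toEnd K L M e ^ k) z)⁆ ≠ 0 := by
  by_contra! hcon
  obtain ⟨hey, hez⟩ := hcon
  obtain ⟨n, rfl⟩ := (⟨hy, hhy, hey⟩ : t.HasPrimitiveVectorWith y c).exists_nat
  obtain ⟨N, hN⟩ := he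
  obtain ⟨k, hk, hk'⟩ := Nat.exists_not_and_succ_of_not_zero_of_exists
    (p := fun k ↦ (toEnd K L M e ^ k) z = 0) (by simpa using hz) ⟨N, by simp [hN]⟩
  have P : t.HasPrimitiveVectorWith ((toEnd K L M e ^ k) z) ((n + 2 + 2 * k : ℕ) : K) :=
    ⟨hk, by simpa using t.lie_h_pow_toEnd_e hhz k, by rwa [IsSl2Triple.lie_e_pow_toEnd_e]⟩
  have h1 := P.lie_e_pow_succ_toEnd_f k
  rw [hez k, eq_comm, smul_eq_zero] at h1
  refine h1.elim (fun h2 ↦ ?_) (P.pow_toEnd_f_ne_zero_of_eq_nat rfl (by lia))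
  have h3 : (((k + 1) * (n + 2 + k) : ℕ) : K) = 0 := by
    rw [← h2]; push_cast; ring
  have h4 := Nat.cast_eq_zero.mp h3
  simp at h4

section RootSpaces

variable {K L : Type*} [Field K] [CharZero K] [LieRing L] [LieAlgebra K L] [FiniteDimensional K L]
  [IsKilling K L] {H : LieSubalgebra K L} [H.IsCartanSubalgebra] [IsTriangularizable K H L]

lemma exists_smul_eq_of_mem_rootSpace {α : Weight K H L} (hα : α.IsNonZero) {x y : L}
    (hx : x ∈ rootSpace H α) (hx0 : x ≠ 0) (hy : y ∈ rootSpace H α) : ∃ c : K, c • x = y := by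
  obtain ⟨c, hc⟩ := (finrank_eq_one_iff_of_nonzero' (⟨x, hx⟩ : rootSpace H α)
    (fun h0 ↦ hx0 (congrArg Subtype.val h0))).mp (finrank_rootSpace_eq_one α hα) ⟨y, hy⟩
  exact ⟨c, congrArg Subtype.val hc⟩

/-- A Lie subalgebra containing the root spaces of two roots contains the root space of their
sum. -/
lemma rootSpace_le_of_eq_add (S : LieSubalgebra K L) {α β γ : Weight K H L}
    (hα : α.IsNonZero) (hγ : γ.IsNonZero) (hγαβ : (γ : H → K) = α + β)
    (hSα : ∀ x ∈ rootSpace H α, x ∈ S) (hSβ : ∀ x ∈ rootSpace H β, x ∈ S) :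
    ∀ x ∈ rootSpace H γ, x ∈ S := by
  obtain ⟨h, e, f, t, he, hf⟩ := exists_isSl2Triple_of_weight_isNonZero hα
  obtain ⟨y, hyβ, hy⟩ := β.exists_ne_zero
  obtain ⟨z, hzγ, hz⟩ := γ.exists_ne_zero
  have hh := t.h_eq_coroot hα he hf
  obtain ⟨y', hy'β, hy'⟩ : ∃ y' ∈ rootSpace H β, ⁅e, y'⁆ ≠ 0 := by
    rcases t.exists_lie_e_ne_zero (K := K) (M := L) (c := β (coroot α))
      (isNilpotent_toEnd_of_mem_rootSpace (M := L) H hα he) hy hz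
      (by rw [hh]; exact lie_eq_smul_of_mem_rootSpace hyβ _)
      (by
        rw [hh]
        refine (lie_eq_smul_of_mem_rootSpace hzγ _).trans ?_
        rw [hγαβ, Pi.add_apply, root_apply_coroot hα, add_comm]) with h1 | ⟨k, hk⟩
    · exact ⟨y, hyβ, h1⟩
    · refine ⟨_, ?_, hk⟩
      have h1 := toEnd_pow_apply_mem hf (toEnd_pow_apply_mem he hzγ k) (k + 1)
      convert! h1 using 2
      rw [hγαβ]
      module
  have hmem : ⁅e, y'⁆ ∈ rootSpace H γ := by
    rw [hγαβ]; exact lie_mem_genWeightSpace_of_mem_genWeightSpace he hy'β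
  intro x hx
  obtain ⟨c, rfl⟩ := exists_smul_eq_of_mem_rootSpace hγ hmem hy' hx
  exact S.smul_mem c (S.lie_mem (hSα e he) (hSβ y' hy'β))

/-- A Lie subalgebra containing the Cartan subalgebra and the root spaces of the simple roots and
of their negatives is everything. -/
lemma eq_top_of_rootSpace_base_le (b : (rootSystem H).Base) (S : LieSubalgebra K L)
    (hH : H ≤ S)
    (hb : ∀ i ∈ b.support, (∀ x ∈ rootSpace H i.val, x ∈ S) ∧
      ∀ x ∈ rootSpace H (-i.val : Weight K H L), x ∈ S) :
    S = ⊤ := by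
  have key (i : H.root) : (∀ x ∈ rootSpace H i.val, x ∈ S) ∧
      ∀ x ∈ rootSpace H (-i.val : Weight K H L), x ∈ S := by
    refine b.induction_add i (p := fun i ↦ (∀ x ∈ rootSpace H i.val, x ∈ S) ∧
      ∀ x ∈ rootSpace H (-i.val : Weight K H L), x ∈ S) (fun i hi ↦ ?_) hb ?_
    · have : ((rootSystem H).reflectionPerm i i).val = -i.val := by
        have h1 := (rootSystem H).root_reflectionPerm i i
        rw [RootPairing.reflection_apply_self] at h1
        ext x
        exact LinearMap.congr_fun h1 x
      rw [this, neg_neg]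
      exact hi.symm
    · intro i j k hk hi hj
      have hk' (x : H) : k.val x = i.val x + j.val x := LinearMap.congr_fun hk x
      have hz (i : H.root) := H.isNonZero_coe_root i
      refine ⟨rootSpace_le_of_eq_add S (hz i) (hz k) (funext hk') hi.1 (hb j hj).1,
        rootSpace_le_of_eq_add S (hz i).neg (hz k).neg (funext fun x ↦ ?_) hi.2 (hb j hj).2⟩
      simp [hk', add_comm]
  have htop := LieModule.iSup_genWeightSpace_eq_top' K H L
  rw [← LieSubmodule.toSubmodule_inj, LieSubmodule.iSup_toSubmodule] at htop
  rw [← LieSubalgebra.toSubmodule_inj, LieSubalgebra.top_toSubmodule, eq_top_iff]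
  rw [LieSubmodule.top_toSubmodule] at htop
  rw [← htop, iSup_le_iff]
  intro χ x hx
  by_cases hχ : χ.IsZero
  · refine hH ?_
    rw [hχ.eq] at hx
    change x ∈ rootSpace H (0 : H → K) at hx
    rwa [rootSpace_zero_eq] at hx
  · exact (key ⟨χ, by simpa using hχ⟩).1 x hx

end RootSpaces

section WeightVectors

variable {K : Type*} [Field K] {𝔤 : Type*} [LieRing 𝔤] [LieAlgebra K 𝔤] {H : LieSubalgebra K 𝔤}
  {M : Type*} [AddCommGroup M] [Module K M] [LieRingModule 𝔤 M] [LieModule K 𝔤 M]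

lemma lie_mem_hWeightSpace {α μ : Dual K H} {x : 𝔤} {m : M}
    (hx : x ∈ hRootSpace K 𝔤 H α) (hm : m ∈ hWeightSpace K 𝔤 H M μ) :
    ⁅x, m⁆ ∈ hWeightSpace K 𝔤 H M (α + μ) := by
  intro h
  have h1 : ⁅(h : 𝔤), x⁆ = α h • x := hx h
  rw [leibniz_lie, h1, hm h, smul_lie, lie_smul, LinearMap.add_apply, add_smul]

lemma tmul_mem_hWeightSpace {N : Type*} [AddCommGroup N] [Module K N] [LieRingModule 𝔤 N]
    [LieModule K 𝔤 N] {μ ν : Dual K H} {m : M} {n : N}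
    (hm : m ∈ hWeightSpace K 𝔤 H M μ) (hn : n ∈ hWeightSpace K 𝔤 H N ν) :
    m ⊗ₜ[K] n ∈ hWeightSpace K 𝔤 H (M ⊗[K] N) (μ + ν) := by
  intro h
  rw [TensorProduct.LieModule.lie_tmul_right, hm h, hn h, LinearMap.add_apply, add_smul,
    TensorProduct.smul_tmul', TensorProduct.tmul_smul]

/-- The difference of two distinct simple roots is not a root. -/
lemma IsRootBase.eq_zero_of_mem_hRootSpace_sub [CharZero K] {Δ : Finset (Dual K H)}
    (hΔ : IsRootBase K 𝔤 H Δ) {α β : Dual K H}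
    (hα : α ∈ Δ) (hβ : β ∈ Δ) (hαβ : α ≠ β) {x : 𝔤} (hx : x ∈ hRootSpace K 𝔤 H (α + -β)) :
    x = 0 := by
  classical
  by_contra hx0
  obtain ⟨c, hc, hc'⟩ := hΔ.2.2 _
    ⟨by rwa [← sub_eq_add_neg, sub_ne_zero], (Submodule.ne_bot_iff _).mpr ⟨x, hx, hx0⟩⟩
  have h1 : ∑ δ ∈ Δ, ((c δ : K) - (if δ = α then 1 else 0) + if δ = β then 1 else 0) • δ = 0 := by
    simp only [add_smul, sub_smul, Finset.sum_add_distrib, Finset.sum_sub_distrib, ite_smul,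
      one_smul, zero_smul, Finset.sum_ite_eq', hα, hβ, if_true, Int.cast_smul_eq_zsmul, ← hc]
    abel
  have h2 := linearIndepOn_finset_iff.mp (show LinearIndepOn K id (Δ : Set (Dual K H)) from hΔ.2.1)
    _ h1
  have hcα : c α = 1 := by
    have := h2 α hα
    simp only [if_true, hαβ, if_false, add_zero, sub_eq_zero] at this
    exact_mod_cast this
  have hcβ : c β = -1 := by
    have := h2 β hβ
    simp only [if_true, hαβ.symm, if_false, sub_zero] at this
    exact_mod_cast eq_neg_of_add_eq_zero_left this
  rcases hc' with h | h
  · have := h β hβ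
    lia
  · have := h α hα
    lia

variable [LieRing.IsNilpotent H]

lemma iSupIndep_hWeightSpace : iSupIndep (hWeightSpace K 𝔤 H M) := by
  have h1 := (LieSubmodule.iSupIndep_toSubmodule).mpr (LieModule.iSupIndep_genWeightSpace K H M)
  refine (h1.comp (DFunLike.coe_injective (F := Dual K H))).mono fun μ m hm ↦ ?_
  exact weightSpace_le_genWeightSpace M _ ((mem_weightSpace _ m).mpr hm)

/-- If weight vectors span a module, then those of weight `μ` span the `μ`-weight space. -/
lemma hWeightSpace_eq_span {ι : Type*} {x : ι → M} {μ : ι → Dual K H}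
    (hx : ∀ i, x i ∈ hWeightSpace K 𝔤 H M (μ i)) (hspan : Submodule.span K (Set.range x) = ⊤)
    (ν : Dual K H) :
    hWeightSpace K 𝔤 H M ν = Submodule.span K (x '' {i | μ i = ν}) := by
  have hle : Submodule.span K (x '' {i | μ i = ν}) ≤ hWeightSpace K 𝔤 H M ν := by
    rw [Submodule.span_le]
    rintro - ⟨i, rfl, rfl⟩
    exact hx i
  refine le_antisymm (fun m hm ↦ ?_) hle
  have hm' : m ∈ Submodule.span K (x '' {i | μ i = ν}) ⊔
      Submodule.span K (x '' {i | μ i = ν}ᶜ) := by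
    rw [← Submodule.span_union, ← Set.image_union, Set.union_compl_self, Set.image_univ, hspan]
    trivial
  obtain ⟨a, ha, b, hb, rfl⟩ := Submodule.mem_sup.mp hm'
  have hb' : b ∈ ⨆ κ, ⨆ (_ : κ ≠ ν), hWeightSpace K 𝔤 H M κ := by
    refine Submodule.span_le.mpr ?_ hb
    rintro - ⟨i, hi, rfl⟩
    exact Submodule.mem_iSup_of_mem (μ i) (Submodule.mem_iSup_of_mem hi (hx i))
  have hb'' : b ∈ hWeightSpace K 𝔤 H M ν := (Submodule.add_mem_iff_right _ (hle ha)).mp hm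
  rw [Submodule.disjoint_def.mp (iSupIndep_hWeightSpace ν) b hb'' hb', add_zero]
  exact ha

end WeightVectors

section RootBase

variable {K : Type*} [Field K] [IsAlgClosed K] [CharZero K]
  {𝔤 : Type*} [LieRing 𝔤] [LieAlgebra K 𝔤] [FiniteDimensional K 𝔤] [LieAlgebra.IsSemisimple K 𝔤]
  {H : LieSubalgebra K 𝔤} [H.IsCartanSubalgebra]

lemma mem_hRootSpace_iff {α : Dual K H} {x : 𝔤} :
    x ∈ hRootSpace K 𝔤 H α ↔ x ∈ rootSpace H α :=
  ⟨fun hx ↦ weightSpace_le_genWeightSpace 𝔤 _ ((mem_weightSpace _ x).mpr hx),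
    fun hx h ↦ lie_eq_smul_of_mem_rootSpace hx h⟩

lemma mem_hRootSpace_zero_iff {x : 𝔤} : x ∈ hRootSpace K 𝔤 H 0 ↔ x ∈ H := by
  rw [mem_hRootSpace_iff]
  change x ∈ rootSpace H (0 : H → K) ↔ _
  rw [rootSpace_zero_eq]
  rfl

lemma isLieRoot_iff {α : Dual K H} :
    IsLieRoot K 𝔤 H α ↔ ∃ i : H.root, Weight.toLinear K H 𝔤 i = α := by
  constructor
  · rintro ⟨h0, h1⟩
    obtain ⟨x, hx, hx0⟩ := (Submodule.ne_bot_iff _).mp h1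
    refine ⟨⟨⟨α, fun h ↦ hx0 ?_⟩, ?_⟩, rfl⟩
    · simpa [h] using mem_hRootSpace_iff.mp hx
    · simpa [Weight.IsNonZero, Weight.IsZero] using h0
  · rintro ⟨i, rfl⟩
    refine ⟨by simp, ?_⟩
    obtain ⟨x, hx, hx0⟩ := i.val.exists_ne_zero
    exact (Submodule.ne_bot_iff _).mpr ⟨x, mem_hRootSpace_iff.mpr hx, hx0⟩

lemma IsLieRoot.neg {α : Dual K H} (hα : IsLieRoot K 𝔤 H α) : IsLieRoot K 𝔤 H (-α) := by
  obtain ⟨i, rfl⟩ := isLieRoot_iff.mp hα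
  exact isLieRoot_iff.mpr ⟨⟨-i.val, by simpa using H.isNonZero_coe_root i⟩, rfl⟩

lemma IsLieRoot.exists_smul_eq {α : Dual K H} (hα : IsLieRoot K 𝔤 H α) {x y : 𝔤}
    (hx : x ∈ hRootSpace K 𝔤 H α) (hx0 : x ≠ 0) (hy : y ∈ hRootSpace K 𝔤 H α) :
    ∃ c : K, c • x = y := by
  obtain ⟨i, rfl⟩ := isLieRoot_iff.mp hα
  have hx' : x ∈ rootSpace H i.val := (mem_hRootSpace_iff (α := Weight.toLinear K H 𝔤 i)).mp hx
  have hy' : y ∈ rootSpace H i.val := (mem_hRootSpace_iff (α := Weight.toLinear K H 𝔤 i)).mp hy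
  exact exists_smul_eq_of_mem_rootSpace (H.isNonZero_coe_root i) hx' hx0 hy'

variable {Δ : Finset (Dual K H)}

/-- A Lie subalgebra containing the Cartan subalgebra and the root spaces of the simple roots and
of their negatives is everything. -/
lemma IsRootBase.eq_top (hΔ : IsRootBase K 𝔤 H Δ) (S : LieSubalgebra K 𝔤) (hH : H ≤ S)
    (hpos : ∀ δ ∈ Δ, ∀ x ∈ hRootSpace K 𝔤 H δ, x ∈ S)
    (hneg : ∀ δ ∈ Δ, ∀ x ∈ hRootSpace K 𝔤 H (-δ), x ∈ S) :
    S = ⊤ := by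
  obtain ⟨hroot, hli, hsum⟩ := hΔ
  let s : Set H.root := {i | Weight.toLinear K H 𝔤 i ∈ Δ}
  have himage : (rootSystem H).root '' s = Δ := by
    ext δ
    constructor
    · rintro ⟨i, hi, rfl⟩
      exact hi
    · intro hδ
      obtain ⟨i, rfl⟩ := isLieRoot_iff.mp (hroot δ hδ)
      exact ⟨i, hδ, rfl⟩
  have hs : LinearIndepOn K (rootSystem H).root s :=
    hli.comp (fun i : s ↦ ⟨(rootSystem H).root i, i.2⟩) fun i j hij ↦
      Subtype.ext ((rootSystem H).root.injective (congrArg Subtype.val hij))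
  have hcl (c : Dual K H → ℤ) (hc : ∀ δ ∈ Δ, 0 ≤ c δ) :
      ∑ δ ∈ Δ, c δ • δ ∈ AddSubmonoid.closure ((rootSystem H).root '' s) := by
    rw [himage]
    refine sum_mem fun δ hδ ↦ ?_
    lift c δ to ℕ using hc δ hδ with n
    rw [natCast_zsmul]
    exact nsmul_mem (AddSubmonoid.subset_closure hδ) n
  let b : (rootSystem H).Base := .mk' (rootSystem H) s hs fun i ↦ by
    obtain ⟨c, hc, hc'⟩ := hsum _ (isLieRoot_iff.mpr ⟨i, rfl⟩)
    rw [rootSystem_root_apply, hc]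
    refine hc'.imp (hcl c) fun h ↦ ?_
    simpa using hcl (-c) (by simpa using h)
  have hb (i : H.root) (hi : i ∈ b.support) : Weight.toLinear K H 𝔤 i ∈ Δ := by
    simpa [b, RootPairing.Base.mk', s] using hi
  exact eq_top_of_rootSpace_base_le b S hH fun i hi ↦
    ⟨fun x hx ↦ hpos _ (hb i hi) x (mem_hRootSpace_iff.mpr hx),
      fun x hx ↦ hneg _ (hb i hi) x (mem_hRootSpace_iff.mpr hx)⟩

end RootBase

/-- The vector `f i₁ · (f i₂ · (⋯ · v))` attached to a word `[i₁, i₂, …]`. -/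
def lieWord {ι L M : Type*} [Bracket L M] (f : ι → L) (v : M) (w : List ι) : M :=
  w.foldr (fun i m ↦ ⁅f i, m⁆) v

lemma lieWord_replicate {ι K L M : Type*} [CommRing K] [LieRing L] [LieAlgebra K L]
    [AddCommGroup M] [Module K M] [LieRingModule L M] [LieModule K L M] (f : ι → L) (v : M)
    (n : ℕ) (i : ι) : lieWord f v (.replicate n i) = (toEnd K L M (f i) ^ n) v := by
  induction n with
  | zero => rfl
  | succ n ih =>
    rw [pow_succ', Module.End.mul_apply, ← ih]
    rfl

lemma lieWord_mem_hWeightSpace {K : Type*} [Field K] {𝔤 : Type*} [LieRing 𝔤] [LieAlgebra K 𝔤]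
    {H : LieSubalgebra K 𝔤} {M : Type*} [AddCommGroup M] [Module K M] [LieRingModule 𝔤 M]
    [LieModule K 𝔤 M] {ι : Type*} {δ : ι → Dual K H} {f : ι → 𝔤}
    (hf : ∀ i, f i ∈ hRootSpace K 𝔤 H (-δ i)) {lam : Dual K H} {v : M}
    (hv : v ∈ hWeightSpace K 𝔤 H M lam) (w : List ι) :
    lieWord f v w ∈ hWeightSpace K 𝔤 H M (lam - (w.map δ).sum) := by
  induction w with
  | nil => simpa [lieWord] using hv
  | cons i w ih =>
    have h := lie_mem_hWeightSpace (hf i) ih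
    rwa [show -δ i + (lam - (w.map δ).sum) = lam - ((i :: w).map δ).sum by
      rw [List.map_cons, List.sum_cons]; abel] at h

/-- The only word in a linearly independent family `δ` that sums to `t • δ a` is the constant word
in `a` of length `t`. -/
lemma eq_replicate_of_sum_eq_nsmul {ι R M : Type*} [Ring R] [CharZero R] [AddCommGroup M]
    [Module R M] {δ : ι → M} (hδ : LinearIndependent R δ) {w : List ι} {a : ι} {t : ℕ}
    (hw : (w.map δ).sum = t • δ a) : w = .replicate t a := by
  classical
  have h1 : Finsupp.linearCombination R δ ((w.map fun i ↦ Finsupp.single i (1 : R)).sum) =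
      Finsupp.linearCombination R δ (Finsupp.single a (t : R)) := by
    rw [map_list_sum, List.map_map, Finsupp.linearCombination_single, Nat.cast_smul_eq_nsmul, ← hw]
    congr 2
    ext i
    simp
  have h2 := hδ h1
  have h3 (i : ι) : (w.map fun j ↦ Finsupp.single j (1 : R)).sum i = (w.count i : R) := by
    clear h1 h2 hw
    induction w with
    | nil => simp
    | cons j w ih => simp [ih, List.count_cons, Finsupp.single_apply, add_comm]
  refine List.perm_replicate.mp (List.perm_iff_count.mpr fun i ↦ ?_)
  have h4 := h3 i
  rw [h2, Finsupp.single_apply] at h4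
  rw [List.count_replicate]
  simp only [beq_iff_eq]
  split_ifs at h4 ⊢ <;> exact_mod_cast h4.symm

section HighestWeight

variable {K : Type*} [Field K] [IsAlgClosed K] [CharZero K]
  {𝔤 : Type*} [LieRing 𝔤] [LieAlgebra K 𝔤] [FiniteDimensional K 𝔤] [LieAlgebra.IsSemisimple K 𝔤]
  {H : LieSubalgebra K 𝔤} [H.IsCartanSubalgebra] {Δ : Finset (Dual K H)}
  {V : Type*} [AddCommGroup V] [Module K V] [LieRingModule 𝔤 V] [LieModule K 𝔤 V]

/-- An irreducible module is spanned by the vectors obtained from a highest weight vector by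
applying lowering operators of simple roots. -/
lemma IsHighestWeightVector.span_lieWord_eq_top [LieModule.IsIrreducible K 𝔤 V]
    (hΔ : IsRootBase K 𝔤 H Δ) {lam : Dual K H} {v : V}
    (hv : IsHighestWeightVector K 𝔤 H Δ V lam v) {f : Δ → 𝔤}
    (hf : ∀ i : Δ, f i ∈ hRootSpace K 𝔤 H (-(i : Dual K H))) (hf0 : ∀ i, f i ≠ 0) :
    Submodule.span K (Set.range (lieWord f v)) = ⊤ := by
  set W := Submodule.span K (Set.range (lieWord f v)) with hW
  have hmem (w : List Δ) : lieWord f v w ∈ W := Submodule.subset_span ⟨w, rfl⟩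
  let S : LieSubalgebra K 𝔤 :=
    { carrier := {x | ∀ m ∈ W, ⁅x, m⁆ ∈ W}
      add_mem' := fun hx hy m hm ↦ by rw [add_lie]; exact W.add_mem (hx m hm) (hy m hm)
      zero_mem' := fun m _ ↦ by rw [zero_lie]; exact W.zero_mem
      smul_mem' := fun c x hx m hm ↦ by rw [smul_lie]; exact W.smul_mem c (hx m hm)
      lie_mem' := fun {x y} hx hy m hm ↦ by
        rw [lie_lie]; exact W.sub_mem (hx _ (hy m hm)) (hy _ (hx m hm)) }
  have hS {x : 𝔤} (hx : ∀ w, ⁅x, lieWord f v w⁆ ∈ W) : x ∈ S := by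
    intro m hm
    induction hm using Submodule.span_induction with
    | mem m hm => obtain ⟨w, rfl⟩ := hm; exact hx w
    | zero => rw [lie_zero]; exact W.zero_mem
    | add m n _ _ hm hn => rw [lie_add]; exact W.add_mem hm hn
    | smul c m _ hm => rw [lie_smul]; exact W.smul_mem c hm
  have hH : H ≤ S := fun h hh ↦ hS fun w ↦ by
    rw [lieWord_mem_hWeightSpace (δ := Subtype.val) hf hv.2.1 w ⟨h, hh⟩]
    exact W.smul_mem _ (hmem w)
  have hST : S = ⊤ := by
    refine hΔ.eq_top S hH (fun δ hδ x hx ↦ hS fun w ↦ ?_) fun δ hδ x hx ↦ ?_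
    · induction w with
      | nil =>
        change ⁅x, v⁆ ∈ W
        rw [hv.2.2 δ hδ x hx]
        exact W.zero_mem
      | cons i w ih =>
        change ⁅x, ⁅f i, lieWord f v w⁆⁆ ∈ W
        rw [leibniz_lie]
        refine W.add_mem ?_ ?_
        · have hxf : ⁅x, f i⁆ ∈ hRootSpace K 𝔤 H (δ + -(i : Dual K H)) :=
            lie_mem_hWeightSpace hx (hf i)
          by_cases hδi : δ = i
          · rw [← hδi, add_neg_cancel, mem_hRootSpace_zero_iff] at hxf
            exact hH hxf _ (hmem w)
          · rw [hΔ.eq_zero_of_mem_hRootSpace_sub hδ i.2 hδi hxf, zero_lie]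
            exact W.zero_mem
        · have hfi : f i ∈ S := hS fun u ↦ hmem (i :: u)
          exact hfi _ ih
    · obtain ⟨c, rfl⟩ := (hΔ.1 δ hδ).neg.exists_smul_eq (hf ⟨δ, hδ⟩) (hf0 _) hx
      exact S.smul_mem c (hS fun u ↦ hmem (⟨δ, hδ⟩ :: u))
  let W' : LieSubmodule K 𝔤 V :=
    { W with lie_mem := fun {x m} hm ↦ (hST ▸ LieSubalgebra.mem_top x : x ∈ S) m hm }
  have hW' : W' ≠ ⊥ := fun h ↦ hv.1 <| by
    have : v ∈ W' := hmem []
    rwa [h, LieSubmodule.mem_bot] at this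
  have htop := (IsSimpleOrder.eq_bot_or_eq_top W').resolve_left hW'
  rw [← LieSubmodule.toSubmodule_inj] at htop
  exact htop

end HighestWeight

/-- The lowering operator applied to a primitive vector of weight `n` gives linearly independent
vectors up to the `n`-th power. -/
lemma IsSl2Triple.HasPrimitiveVectorWith.linearIndependent_pow_toEnd_f {K L M : Type*} [Field K]
    [CharZero K] [LieRing L] [LieAlgebra K L] [AddCommGroup M] [Module K M] [LieRingModule L M]
    [LieModule K L M] [FiniteDimensional K M] {h e f : L} {t : IsSl2Triple h e f} {v : M} {n : ℕ}
    (P : t.HasPrimitiveVectorWith v (n : K)) :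
    LinearIndependent K fun i : Fin (n + 1) ↦ (toEnd K L M f ^ (i : ℕ)) v := by
  refine Module.End.eigenvectors_linearIndependent' (toEnd K L M h)
    (fun i : Fin (n + 1) ↦ (n - 2 * (i : ℕ) : K)) (fun i j hij ↦ ?_) _ fun i ↦ ?_
  · have : ((i : ℕ) : K) = (j : ℕ) := by simpa using hij
    exact Fin.ext (by exact_mod_cast this)
  · rw [Module.End.hasEigenvector_iff, Module.End.mem_eigenspace_iff]
    exact ⟨P.lie_h_pow_toEnd_f i, P.pow_toEnd_f_ne_zero_of_eq_nat rfl (by lia)⟩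

end Auxiliary

/-- Let `𝔤` be a finite-dimensional semisimple Lie algebra over an
algebraically closed field `K` of characteristic `0`, with Cartan subalgebra `H` and base `Δ`
of simple roots, and let `V` be the irreducible `𝔤`-module of highest weight `λ`.  Then for
every simple root `α ∈ Δ` and every integer `0 ≤ t ≤ ⟨λ, α⟩`, the weight `2λ - tα` occurs in
the tensor square `V ⊗ V` with multiplicity exactly `t + 1`:
`dim (V(λ) ⊗ V(λ))_{2λ - tα} = t + 1`.
(Here `⟨λ, α⟩ = λ(hα)` where `hα` is the coroot of `α`; for the finite-dimensional module `V`
this is a natural number `N`.) -/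
theorem finrank_weightSpace_tensorSquare
    (K : Type*) [Field K] [IsAlgClosed K] [CharZero K]
    (𝔤 : Type*) [LieRing 𝔤] [LieAlgebra K 𝔤] [FiniteDimensional K 𝔤]
    [LieAlgebra.IsSemisimple K 𝔤]
    (H : LieSubalgebra K 𝔤) [H.IsCartanSubalgebra]
    (Δ : Finset (Module.Dual K H)) (hΔ : IsRootBase K 𝔤 H Δ)
    (V : Type*) [AddCommGroup V] [Module K V] [LieRingModule 𝔤 V] [LieModule K 𝔤 V]
    [FiniteDimensional K V] [LieModule.IsIrreducible K 𝔤 V]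
    (lam : Module.Dual K H) (hlam : IsHighestWeight K 𝔤 H Δ V lam)
    (α : Module.Dual K H) (hα : α ∈ Δ)
    (hcor : H) (hhcor : IsCoroot K 𝔤 H α hcor)
    (N : ℕ) (hN : lam hcor = (N : K))
    (t : ℕ) (ht : t ≤ N) :
    Module.finrank K (hWeightSpace K 𝔤 H (V ⊗[K] V) (2 • lam - t • α)) = t + 1 := by
  obtain ⟨v, hv⟩ := hlam
  obtain ⟨hα2, e, he, f, hf, hef⟩ := hhcor
  have T : IsSl2Triple (hcor : 𝔤) e f := by
    refine ⟨fun h0 ↦ ?_, hef, ?_, ?_⟩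
    · rw [(by simpa using h0 : hcor = 0), map_zero] at hα2
      exact two_ne_zero hα2.symm
    · rw [he hcor, hα2, ofNat_smul_eq_nsmul]
    · rw [hf hcor, LinearMap.neg_apply, hα2, neg_smul, ofNat_smul_eq_nsmul]
  have hP : T.HasPrimitiveVectorWith v (N : K) :=
    ⟨hv.1, by rw [hv.2.1 hcor, hN], hv.2.2 α hα e he⟩
  have hf0 : f ≠ 0 := T.f_ne_zero
  have hF (i : Δ) : ∃ x ∈ hRootSpace K 𝔤 H (-(i : Module.Dual K H)), x ≠ 0 ∧
      (i = ⟨α, hα⟩ → x = f) := by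
    by_cases hi : i = ⟨α, hα⟩
    · exact ⟨f, hi ▸ hf, hf0, fun _ ↦ rfl⟩
    · obtain ⟨x, hx, hx0⟩ := (Submodule.ne_bot_iff _).mp (hΔ.1 i i.2).neg.2
      exact ⟨x, hx, hx0, fun h ↦ absurd h hi⟩
  choose F hF hF0 hFα using hF
  have hspan := hv.span_lieWord_eq_top hΔ hF hF0
  let x (p : List Δ × List Δ) : V ⊗[K] V := lieWord F v p.1 ⊗ₜ[K] lieWord F v p.2
  have hxspan : Submodule.span K (Set.range x) = ⊤ := by
    rw [← TensorProduct.map₂_mk_top_top_eq_top, ← hspan, Submodule.map₂_span_span,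
      Set.image2_range]
    rfl
  have hset : x '' {p | (lam - (p.1.map Subtype.val).sum) + (lam - (p.2.map Subtype.val).sum) =
      2 • lam - t • α} = Set.range fun i : Fin (t + 1) ↦
        (LieModule.toEnd K 𝔤 V f ^ (i : ℕ)) v ⊗ₜ[K] (LieModule.toEnd K 𝔤 V f ^ (t - i)) v := by
    have hrep (n : ℕ) : lieWord F v (.replicate n ⟨α, hα⟩) = (LieModule.toEnd K 𝔤 V f ^ n) v := by
      rw [lieWord_replicate (K := K), hFα _ rfl]
    ext y
    constructor
    · rintro ⟨⟨w, w'⟩, hw, rfl⟩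
      have hsum : ((w ++ w').map Subtype.val).sum = t • α := by
        rw [List.map_append, List.sum_append, ← sub_right_inj (a := 2 • lam), ← hw]
        module
      have h1 := eq_replicate_of_sum_eq_nsmul hΔ.2.1 (a := ⟨α, hα⟩) hsum
      obtain ⟨hlen, hw1, hw2⟩ := List.append_eq_replicate_iff.mp h1
      refine ⟨⟨w.length, by lia⟩, ?_⟩
      simp only [x]
      rw [hw1, hw2, hrep, hrep, List.length_replicate, ← hlen, Nat.add_sub_cancel_left]
    · rintro ⟨i, rfl⟩
      refine ⟨(.replicate i ⟨α, hα⟩, .replicate (t - i) ⟨α, hα⟩), ?_, ?_⟩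
      · have hk : (i : ℕ) • α + (t - i) • α = t • α := by
          rw [← add_nsmul, Nat.add_sub_cancel' (Nat.lt_succ_iff.mp i.2)]
        simp only [Set.mem_ofPred_eq, List.map_replicate, List.sum_replicate]
        rw [← hk, two_nsmul]
        abel
      · simp only [x, hrep]
  have hli : LinearIndependent K fun i : Fin (t + 1) ↦
      (LieModule.toEnd K 𝔤 V f ^ (i : ℕ)) v ⊗ₜ[K] (LieModule.toEnd K 𝔤 V f ^ (t - i)) v :=
    (hP.linearIndependent_pow_toEnd_f.tmul_of_isDomain hP.linearIndependent_pow_toEnd_f).comp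
      (fun i : Fin (t + 1) ↦ ((⟨i, by lia⟩, ⟨t - i, by lia⟩) : Fin (N + 1) × Fin (N + 1)))
      fun i j hij ↦ Fin.ext (congrArg (fun p ↦ (p.1 : ℕ)) hij)
  rw [hWeightSpace_eq_span (x := x) (fun p ↦ tmul_mem_hWeightSpace
    (lieWord_mem_hWeightSpace (δ := Subtype.val) hF hv.2.1 p.1)
    (lieWord_mem_hWeightSpace (δ := Subtype.val) hF hv.2.1 p.2)) hxspan, hset,
    finrank_span_eq_card hli, Fintype.card_fin]
end
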